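/- arXiv:2407.09632 — 9 statements merged into one kernel-verified Lean document; each statement's English description precedes it below -/
import Mathlib

section
/- Let F : ℝ → [0,1) be a nondecreasing function with lim_{x→∞} F(x) = 1, and let Z₁, Z₂ be real random variables on a common probability space such that Z₂ is supported on a neighbourhood of infinity. Then lim_{v→∞} 𝔼[F(Z₁) | Z₂ > v] = 1 if and only if for every c ∈ ℝ, lim_{v→∞} ℙ(Z₁ > c | Z₂ > v) = 1. -/
open MeasureTheory Filter
open scoped Topology

/-- Bounds on the integral of a monotone transform in terms of an upper tail of the variable. -/
lemma integral_monotone_comp_bounds {Ω : Type*} [MeasurableSpace Ω] (ν : Measure Ω)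
    [IsFiniteMeasure ν] {F : ℝ → ℝ} (hF_mono : Monotone F) (hF_nonneg : ∀ x, 0 ≤ F x)
    (hF_le : ∀ x, F x ≤ 1) {Z : Ω → ℝ} (hZ : Measurable Z) (c : ℝ) :
    F c * ν.real {ω | c < Z ω} ≤ ∫ ω, F (Z ω) ∂ν ∧
      ∫ ω, F (Z ω) ∂ν ≤ F c * ν.real Set.univ + (1 - F c) * ν.real {ω | c < Z ω} := by
  have hs : MeasurableSet {ω | c < Z ω} := measurableSet_lt measurable_const hZ
  have hint : Integrable (fun ω => F (Z ω)) ν :=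
    .of_bound (hF_mono.measurable.comp hZ).aestronglyMeasurable 1
      (.of_forall fun ω => by
        rw [Real.norm_of_nonneg (hF_nonneg _)]
        exact hF_le _)
  have hind : Integrable ({ω | c < Z ω}.indicator (1 : Ω → ℝ)) ν :=
    (integrable_const (1 : ℝ)).indicator hs
  constructor
  · rw [← integral_indicator_one hs, ← integral_const_mul]
    refine integral_mono (hind.const_mul _) hint fun ω => ?_
    by_cases h : c < Z ω
    · simpa [Set.indicator, h] using hF_mono h.le
    · simpa [Set.indicator, h] using hF_nonneg _
  · have heq : F c * ν.real Set.univ + (1 - F c) * ν.real {ω | c < Z ω}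
        = ∫ ω, (F c + (1 - F c) * {ω | c < Z ω}.indicator (1 : Ω → ℝ) ω) ∂ν := by
      rw [integral_add (integrable_const _) (hind.const_mul _), integral_const_mul,
        integral_indicator_one hs, integral_const, smul_eq_mul, mul_comm (F c)]
    rw [heq]
    refine integral_mono hint ((integrable_const _).add (hind.const_mul _)) fun ω => ?_
    by_cases h : c < Z ω
    · simpa [Set.indicator, h] using hF_le _
    · simpa [Set.indicator, h] using hF_mono (not_lt.mp h)

/-- For a nondecreasing `F : ℝ → [0,1)` with `F → 1` at infinity and random
variables `Z₁, Z₂` with `Z₂` supported on a neighbourhood of infinity,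
`lim_{v→∞} 𝔼[F(Z₁) ∣ Z₂ > v] = 1` iff for all `c`, `lim_{v→∞} ℙ(Z₁ > c ∣ Z₂ > v) = 1`. -/
theorem stmt0
    {Ω : Type*} [MeasurableSpace Ω] (μ : Measure Ω) [IsProbabilityMeasure μ]
    (F : ℝ → ℝ) (hF_mono : Monotone F) (hF_nonneg : ∀ x, 0 ≤ F x)
    (hF_lt : ∀ x, F x < 1) (hF_lim : Tendsto F atTop (𝓝 1))
    (Z₁ Z₂ : Ω → ℝ) (hZ₁ : Measurable Z₁) (hZ₂ : Measurable Z₂)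
    (hsupp : ∀ v : ℝ, 0 < μ {ω | v < Z₂ ω}) :
    Tendsto (fun v : ℝ =>
        (∫ ω in {ω | v < Z₂ ω}, F (Z₁ ω) ∂μ) / (μ {ω | v < Z₂ ω}).toReal)
      atTop (𝓝 1)
    ↔ ∀ c : ℝ, Tendsto (fun v : ℝ =>
        (μ ({ω | c < Z₁ ω} ∩ {ω | v < Z₂ ω})).toReal / (μ {ω | v < Z₂ ω}).toReal)
      atTop (𝓝 1) := by
  have hm (v : ℝ) : 0 < (μ {ω | v < Z₂ ω}).toReal :=
    ENNReal.toReal_pos (hsupp v).ne' (measure_ne_top _ _)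
  have hbounds (c v : ℝ) :
      F c * (μ ({ω | c < Z₁ ω} ∩ {ω | v < Z₂ ω})).toReal
          ≤ ∫ ω in {ω | v < Z₂ ω}, F (Z₁ ω) ∂μ ∧
        ∫ ω in {ω | v < Z₂ ω}, F (Z₁ ω) ∂μ ≤ F c * (μ {ω | v < Z₂ ω}).toReal
          + (1 - F c) * (μ ({ω | c < Z₁ ω} ∩ {ω | v < Z₂ ω})).toReal := by
    have h := integral_monotone_comp_bounds (μ.restrict {ω | v < Z₂ ω}) hF_mono hF_nonneg
      (fun x => (hF_lt x).le) hZ₁ c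
    rwa [measureReal_restrict_apply (measurableSet_lt measurable_const hZ₁),
      measureReal_restrict_apply_univ] at h
  constructor
  · intro h c
    have hc : 0 < 1 - F c := sub_pos.mpr (hF_lt c)
    have hlow := (h.sub_const (F c)).div_const (1 - F c)
    rw [div_self hc.ne'] at hlow
    refine tendsto_of_tendsto_of_tendsto_of_le_of_le hlow tendsto_const_nhds
      (fun v => ?_) (fun v => ?_)
    · have hb := (div_le_div_iff_of_pos_right (hm v)).mpr (hbounds c v).2
      rw [add_div, mul_div_assoc, mul_div_assoc, div_self (hm v).ne', mul_one] at hb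
      rw [div_le_iff₀ hc]
      linarith
    · exact div_le_one_of_le₀ (ENNReal.toReal_mono (measure_ne_top _ _)
        (measure_mono Set.inter_subset_right)) (hm v).le
  · intro h
    refine tendsto_order.mpr ⟨fun a ha => ?_, fun a ha => .of_forall fun v => ?_⟩
    · obtain ⟨c, hc⟩ := (hF_lim.eventually_const_lt ha).exists
      have hlim := (h c).const_mul (F c)
      rw [mul_one] at hlim
      filter_upwards [hlim.eventually_const_lt hc] with v hv
      refine hv.trans_le ?_
      rw [← mul_div_assoc]
      exact (div_le_div_iff_of_pos_right (hm v)).mpr (hbounds c v).1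
    · refine lt_of_le_of_lt (div_le_one_of_le₀ ?_ (hm v).le) ha
      have hle : (μ ({ω | 0 < Z₁ ω} ∩ {ω | v < Z₂ ω})).toReal ≤ (μ {ω | v < Z₂ ω}).toReal :=
        ENNReal.toReal_mono (measure_ne_top _ _) (measure_mono Set.inter_subset_right)
      have hmul := mul_le_mul_of_nonneg_left hle (sub_nonneg.mpr (hF_lt 0).le)
      linarith [(hbounds 0 v).2]
end

section
/- Let Z₁ and Z₂ be independent real random variables on a common probability space, with Z₁ supported on a neighbourhood of infinity, and let h : ℝ² → ℝ be a measurable function such that for every z₂ ∈ ℝ, h(v, z₂) → +∞ as v → ∞. Then for every c ∈ ℝ, lim_{v→∞} ℙ(h(Z₁, Z₂) > c | Z₁ > v) = 1. -/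
open MeasureTheory Filter ProbabilityTheory
open scoped Topology

/-- A probability measure gives measure tending to `1` to the superlevel sets of a family of
functions diverging pointwise to infinity. -/
theorem tendsto_measure_lt_of_tendsto_atTop (ν : Measure ℝ) [IsProbabilityMeasure ν]
    (h : ℝ → ℝ → ℝ) (hmeas : Measurable (Function.uncurry h))
    (hlim : ∀ z : ℝ, Tendsto (fun v => h v z) atTop atTop) (c : ℝ) :
    Tendsto (fun u => ν {z | c < h u z}) atTop (𝓝 1) := by
  have key := tendsto_measure_of_tendsto_indicator_of_isFiniteMeasure (A := Set.univ)
    (As := fun u : ℝ => {z | c < h u z}) atTop ν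
    (fun u => measurableSet_lt measurable_const (hmeas.comp measurable_prodMk_left))
    (fun z => by
      filter_upwards [(hlim z).eventually_gt_atTop c] with u hu
      simpa using hu)
  simpa using key

/-- If every slice of `T` above `s` has `ν`-measure at least `q`, then
`q * ρ s ≤ (ρ.prod ν) (T ∩ Prod.fst ⁻¹' s)`. -/
theorem mul_measure_le_prod_inter_fst_preimage {α β : Type*} [MeasurableSpace α]
    [MeasurableSpace β] (ρ : Measure α) (ν : Measure β) [SFinite ν] {s : Set α} {T : Set (α × β)}
    (hs : MeasurableSet s) (hT : MeasurableSet T) {q : ENNReal}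
    (hq : ∀ u ∈ s, q ≤ ν (Prod.mk u ⁻¹' T)) :
    q * ρ s ≤ ρ.prod ν (T ∩ Prod.fst ⁻¹' s) := by
  rw [Measure.prod_apply (hT.inter (measurable_fst hs)), ← lintegral_indicator_const hs]
  refine lintegral_mono fun u => Set.indicator_apply_le' (fun hu => ?_) (fun _ => zero_le)
  simpa [Set.preimage_inter, ← Set.preimage_comp, Function.comp_def, hu] using hq u hu

/-- If `Z₁ ⟂ Z₂`, `Z₁` is supported on a neighbourhood of infinity, and
`h(v, z₂) → ∞` as `v → ∞` for every `z₂`, then for every `c`,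
`ℙ(h(Z₁,Z₂) > c ∣ Z₁ > v) → 1` as `v → ∞`. -/
theorem stmt1
    {Ω : Type*} [MeasurableSpace Ω] (μ : Measure Ω) [IsProbabilityMeasure μ]
    (Z₁ Z₂ : Ω → ℝ) (hZ₁ : Measurable Z₁) (hZ₂ : Measurable Z₂)
    (hindep : IndepFun Z₁ Z₂ μ)
    (hsupp : ∀ v : ℝ, 0 < μ {ω | v < Z₁ ω})
    (h : ℝ → ℝ → ℝ) (hmeas : Measurable (Function.uncurry h))
    (hlim : ∀ z₂ : ℝ, Tendsto (fun v => h v z₂) atTop atTop)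
    (c : ℝ) :
    Tendsto (fun v : ℝ =>
        (μ ({ω | c < h (Z₁ ω) (Z₂ ω)} ∩ {ω | v < Z₁ ω})).toReal /
          (μ {ω | v < Z₁ ω}).toReal) atTop (𝓝 1) := by
  have hpr := (indepFun_iff_map_prod_eq_prod_map_map hZ₁.aemeasurable hZ₂.aemeasurable).1 hindep
  have : IsProbabilityMeasure (μ.map Z₂) := Measure.isProbabilityMeasure_map hZ₂.aemeasurable
  have hp := tendsto_measure_lt_of_tendsto_atTop (μ.map Z₂) h hmeas hlim c
  have hT : MeasurableSet {p : ℝ × ℝ | c < h p.1 p.2} := measurableSet_lt measurable_const hmeas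
  have hpos (v : ℝ) : 0 < (μ {ω | v < Z₁ ω}).toReal :=
    ENNReal.toReal_pos (hsupp v).ne' (measure_ne_top _ _)
  refine tendsto_order.2 ⟨fun a ha => ?_, fun a ha => Eventually.of_forall fun v => ?_⟩
  · obtain ⟨b, hab, hb⟩ := exists_between (max_lt ha one_pos)
    have hb0 : 0 ≤ b := (le_max_right a 0).trans hab.le
    obtain ⟨N, hN⟩ := eventually_atTop.1
      (hp.eventually (lt_mem_nhds (ENNReal.ofReal_lt_one.2 hb)))
    filter_upwards [eventually_ge_atTop N] with v hv
    refine ((le_max_left a 0).trans_lt hab).trans_le ((le_div_iff₀ (hpos v)).2 ?_)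
    have hle := mul_measure_le_prod_inter_fst_preimage (μ.map Z₁) (μ.map Z₂)
      (measurableSet_Ioi (a := v)) hT (fun u hu => (hN u (hv.trans (le_of_lt hu))).le)
    rw [← hpr, Measure.map_apply (hZ₁.prodMk hZ₂) (hT.inter (measurable_fst measurableSet_Ioi)),
      Measure.map_apply hZ₁ measurableSet_Ioi] at hle
    have hreal := ENNReal.toReal_mono (measure_ne_top _ _) hle
    rwa [ENNReal.toReal_mul, ENNReal.toReal_ofReal hb0] at hreal
  · exact ((div_le_one (hpos v)).2 (ENNReal.toReal_mono (measure_ne_top _ _)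
      (measure_mono Set.inter_subset_right))).trans_lt ha
end

section
/- Let Z₁ and Z₂ be independent real random variables on a common probability space with ℙ(|Z₁| > v) > 0 for every v ∈ ℝ, and let h : ℝ² → ℝ be a measurable function such that for every z₂ ∈ ℝ, |h(v, z₂)| → +∞ as |v| → ∞. Then for every c ∈ ℝ, lim_{v→∞} ℙ(|h(Z₁, Z₂)| > c | |Z₁| > v) = 1. -/
open MeasureTheory Filter ProbabilityTheory
open scoped Topology ENNReal

/-- If every point of a finite measure space eventually satisfies `p i`, then the measure of
`{x | p i x}` tends to the total mass. -/
theorem tendsto_measure_setOf_of_forall_eventually {α ι : Type*} [MeasurableSpace α]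
    {l : Filter ι} [l.IsCountablyGenerated] (ν : Measure α) [IsFiniteMeasure ν]
    {p : ι → α → Prop} (hp : ∀ i, MeasurableSet {x | p i x}) (h : ∀ x, ∀ᶠ i in l, p i x) :
    Tendsto (fun i => ν {x | p i x}) l (𝓝 (ν Set.univ)) :=
  tendsto_measure_of_tendsto_indicator_of_isFiniteMeasure l ν hp
    fun x => (h x).mono fun i hi => by simpa using hi

/-- A lower bound on the sections over `A` gives a lower bound on the probability that
`X ∈ A` and `(X, Y) ∈ S`, for independent `X` and `Y`. -/
theorem mul_measure_le_of_forall_le_measure_section {Ω α β : Type*} [MeasurableSpace Ω]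
    [MeasurableSpace α] [MeasurableSpace β] {μ : Measure Ω} [IsFiniteMeasure μ]
    {X : Ω → α} {Y : Ω → β} (hX : Measurable X) (hY : Measurable Y) (hXY : IndepFun X Y μ)
    {S : Set (α × β)} (hS : MeasurableSet S) {A : Set α} (hA : MeasurableSet A) {r : ℝ≥0∞}
    (hr : ∀ a ∈ A, r ≤ μ.map Y (Prod.mk a ⁻¹' S)) :
    r * μ (X ⁻¹' A) ≤ μ ((fun ω => (X ω, Y ω)) ⁻¹' S ∩ X ⁻¹' A) := by
  have hprod := (indepFun_iff_map_prod_eq_prod_map_map hX.aemeasurable hY.aemeasurable).1 hXY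
  have hSA : MeasurableSet (S ∩ Prod.fst ⁻¹' A) := hS.inter (measurable_fst hA)
  calc r * μ (X ⁻¹' A) = ∫⁻ _ in A, r ∂μ.map X := by
        rw [setLIntegral_const, Measure.map_apply hX hA]
    _ ≤ ∫⁻ a in A, μ.map Y (Prod.mk a ⁻¹' (S ∩ Prod.fst ⁻¹' A)) ∂μ.map X := by
        refine setLIntegral_mono' hA fun a ha => (hr a ha).trans (measure_mono ?_)
        exact fun b hb => ⟨hb, ha⟩
    _ ≤ ∫⁻ a, μ.map Y (Prod.mk a ⁻¹' (S ∩ Prod.fst ⁻¹' A)) ∂μ.map X := setLIntegral_le_lintegral _ _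
    _ = μ ((fun ω => (X ω, Y ω)) ⁻¹' S ∩ X ⁻¹' A) := by
        rw [← Measure.prod_apply hSA, ← hprod, Measure.map_apply (hX.prodMk hY) hSA]
        rfl

/-- If `Z₁ ⟂ Z₂`, `ℙ(|Z₁| > v) > 0` for all `v`, and `|h(v, z₂)| → ∞`
as `|v| → ∞` for every `z₂`, then for every `c`,
`ℙ(|h(Z₁,Z₂)| > c ∣ |Z₁| > v) → 1` as `v → ∞`. -/
theorem stmt3
    {Ω : Type*} [MeasurableSpace Ω] (μ : Measure Ω) [IsProbabilityMeasure μ]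
    (Z₁ Z₂ : Ω → ℝ) (hZ₁ : Measurable Z₁) (hZ₂ : Measurable Z₂)
    (hindep : IndepFun Z₁ Z₂ μ)
    (hsupp : ∀ v : ℝ, 0 < μ {ω | v < |Z₁ ω|})
    (h : ℝ → ℝ → ℝ) (hmeas : Measurable (Function.uncurry h))
    (hlim : ∀ z₂ : ℝ, Tendsto (fun v => |h v z₂|) (cocompact ℝ) atTop)
    (c : ℝ) :
    Tendsto (fun v : ℝ =>
        (μ ({ω | c < |h (Z₁ ω) (Z₂ ω)|} ∩ {ω | v < |Z₁ ω|})).toReal /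
          (μ {ω | v < |Z₁ ω|}).toReal) atTop (𝓝 1) := by
  have : IsProbabilityMeasure (μ.map Z₂) := Measure.isProbabilityMeasure_map hZ₂.aemeasurable
  have hS : MeasurableSet {p : ℝ × ℝ | c < |h p.1 p.2|} :=
    measurableSet_lt measurable_const (continuous_abs.measurable.comp hmeas)
  have hcocompact : cocompact ℝ = comap norm atTop := by
    rw [comap_norm_atTop, Metric.cobounded_eq_cocompact]
  have : (cocompact ℝ).IsCountablyGenerated := hcocompact ▸ inferInstance
  have hsection : Tendsto (fun u => μ.map Z₂ {z | c < |h u z|}) (cocompact ℝ) (𝓝 1) := by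
    simpa using tendsto_measure_setOf_of_forall_eventually (μ.map Z₂)
      (p := fun u z => c < |h u z|) (fun u => measurable_prodMk_left hS)
      fun z => (hlim z).eventually_gt_atTop c
  have hpos (v : ℝ) : 0 < (μ {ω | v < |Z₁ ω|}).toReal :=
    ENNReal.toReal_pos (hsupp v).ne' (measure_ne_top _ _)
  refine tendsto_order.2 ⟨fun a ha => ?_, fun a ha => Eventually.of_forall fun v => ?_⟩
  · obtain ⟨b, hab, hb⟩ := exists_between (max_lt ha zero_lt_one)
    have hb0 : 0 ≤ b := (le_max_right a 0).trans hab.le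
    have hev := hsection.eventually_const_lt (ENNReal.ofReal_lt_one.2 hb)
    rw [hcocompact, eventually_comap] at hev
    obtain ⟨V, hV⟩ := eventually_atTop.1 hev
    filter_upwards [eventually_ge_atTop V] with v hv
    have hA : MeasurableSet {u : ℝ | v < |u|} :=
      measurableSet_lt measurable_const continuous_abs.measurable
    have key := mul_measure_le_of_forall_le_measure_section hZ₁ hZ₂ hindep hS hA
      fun u (hu : v < |u|) => (hV |u| (hv.trans hu.le) u rfl).le
    have key' := ENNReal.toReal_mono (measure_ne_top _ _) key
    rw [ENNReal.toReal_mul, ENNReal.toReal_ofReal hb0] at key'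
    exact ((le_max_left a 0).trans_lt hab).trans_le ((le_div_iff₀ (hpos v)).2 key')
  · refine lt_of_le_of_lt ((div_le_one (hpos v)).2 ?_) ha
    exact ENNReal.toReal_mono (measure_ne_top _ _) (measure_mono Set.inter_subset_right)
end

section
/- Let (A, B) be a pair of real random variables with A > 0 almost surely satisfying the Grey assumption with index α > 0, and let X be a real random variable independent of (A, B) such that either X is regularly varying with some tail index θ > 0, or ℙ(X > t) = o(ℙ(B > t)) as t → ∞. Then ℙ(AX + B > t) ~ ℙ(AX > t) + ℙ(B > t) as t → ∞, i.e. lim_{t→∞} ℙ(AX + B > t)/(ℙ(AX > t) + ℙ(B > t)) = 1. -/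
open MeasureTheory Filter ProbabilityTheory Asymptotics
open scoped Topology ENNReal

/-- A measurable function `l`, positive on `(0,∞)`, is slowly varying if
`l(cx)/l(x) → 1` as `x → ∞` for every `c > 0`. -/
def SlowlyVarying (l : ℝ → ℝ) : Prop :=
  Measurable l ∧ (∀ x > 0, 0 < l x) ∧
    ∀ c > 0, Tendsto (fun x => l (c * x) / l x) atTop (𝓝 1)

/-- A random variable `X` is regularly varying with tail index `θ > 0` if there is a
slowly varying `L` with `ℙ(X > x) = x^{-θ} L(x)` for all sufficiently large `x`. -/
def RegularlyVaryingTail {Ω : Type*} [MeasurableSpace Ω] (μ : Measure Ω)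
    (X : Ω → ℝ) (θ : ℝ) : Prop :=
  ∃ L : ℝ → ℝ, SlowlyVarying L ∧
    ∀ᶠ x in atTop, (μ {ω | x < X ω}).toReal = x ^ (-θ) * L x

/-- The pair `(A, B)` satisfies the Grey assumption with index `α > 0`:
`𝔼|A|^α < 1`, `𝔼|A|^{α+ν} < ∞` for some `ν > 0`, and there are `p_α > 0`, `q_α ≥ 0`
with `p_α + q_α = 1` and a slowly varying `l` with
`ℙ(B > x) ~ p_α x^{-α} l(x)` and `ℙ(-B > x) ~ q_α x^{-α} l(x)`. -/
def GreyAssumption {Ω : Type*} [MeasurableSpace Ω] (μ : Measure Ω)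
    (A B : Ω → ℝ) (α : ℝ) : Prop :=
  (∃ ν > 0, (∫⁻ ω, ENNReal.ofReal (|A ω| ^ α) ∂μ) < 1 ∧
      (∫⁻ ω, ENNReal.ofReal (|A ω| ^ (α + ν)) ∂μ) < ⊤) ∧
  ∃ (p q : ℝ) (l : ℝ → ℝ), 0 < p ∧ 0 ≤ q ∧ p + q = 1 ∧ SlowlyVarying l ∧
    Tendsto (fun x => (μ {ω | x < B ω}).toReal / (x ^ (-α) * l x)) atTop (𝓝 p) ∧
    Tendsto (fun x => (μ {ω | x < -B ω}).toReal / (x ^ (-α) * l x)) atTop (𝓝 q)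

lemma SlowlyVarying.tendsto_tail_ratio {l g : ℝ → ℝ} {α p : ℝ} (hl : SlowlyVarying l)
    (hp : 0 < p) (hg : Tendsto (fun x => g x / (x ^ (-α) * l x)) atTop (𝓝 p))
    {c : ℝ} (hc : 0 < c) :
    Tendsto (fun x => g (c * x) / g x) atTop (𝓝 (c ^ (-α))) := by
  have hcx : Tendsto (fun x : ℝ => c * x) atTop atTop := tendsto_id.const_mul_atTop hc
  have h1 := ((hg.comp hcx).div hg hp.ne').mul ((hl.2.2 c hc).const_mul (c ^ (-α)))
  rw [div_self hp.ne', one_mul, mul_one] at h1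
  refine h1.congr' ?_
  filter_upwards [eventually_gt_atTop 0, hg.eventually_ne hp.ne'] with x hx hgx
  have hlx := (hl.2.1 x hx).ne'
  have hlcx := (hl.2.1 (c * x) (by positivity)).ne'
  have hxα : x ^ (-α) ≠ 0 := (Real.rpow_pos_of_pos hx _).ne'
  have hcα : c ^ (-α) ≠ 0 := (Real.rpow_pos_of_pos hc _).ne'
  have hgx' : g x ≠ 0 := by
    rintro h
    simp [h] at hgx
  simp only [Function.comp_apply, Pi.div_apply]
  rw [Real.mul_rpow hc.le hx.le]
  field_simp

lemma SlowlyVarying.tail_pos {l g : ℝ → ℝ} {α p : ℝ} (hl : SlowlyVarying l)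
    (hp : 0 < p) (hg : Tendsto (fun x => g x / (x ^ (-α) * l x)) atTop (𝓝 p)) :
    ∀ᶠ x in atTop, 0 < g x := by
  filter_upwards [eventually_gt_atTop 0, hg.eventually_const_lt hp] with x hx hgx
  have hlx := hl.2.1 x hx
  exact (div_pos_iff_of_pos_right (by positivity)).1 hgx

/-- A regularly varying function changes little under multiplication of its argument by a
constant close to `1`. -/
lemma eventually_le_of_tendsto_ratio {g : ℝ → ℝ} {α : ℝ} (hpos : ∀ᶠ x in atTop, 0 < g x)
    (hg : ∀ c > 0, Tendsto (fun x => g (c * x) / g x) atTop (𝓝 (c ^ (-α))))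
    {δ : ℝ} (hδ : 0 < δ) :
    ∀ᶠ c in 𝓝[<] (1 : ℝ), ∀ᶠ x in atTop, g (c * x) ≤ (1 + δ) * g x := by
  have hcont : ContinuousAt (fun c : ℝ => c ^ (-α)) 1 :=
    Real.continuousAt_rpow_const _ _ (Or.inl one_ne_zero)
  have h1 : ∀ᶠ c in 𝓝 (1 : ℝ), c ^ (-α) < 1 + δ :=
    hcont.eventually_lt continuousAt_const (by simpa using hδ)
  filter_upwards [nhdsWithin_le_nhds h1,
    nhdsWithin_le_nhds (lt_mem_nhds (zero_lt_one' ℝ))] with c hc hc0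
  filter_upwards [hpos, (hg c hc0).eventually_lt_const hc] with x hx hx'
  exact ((div_lt_iff₀ hx).1 hx').le

/-- A Potter-type bound for monotone regularly varying functions. -/
lemma Antitone.exists_potter_bound {g : ℝ → ℝ} {α β : ℝ} (hanti : Antitone g)
    (hpos : ∀ᶠ x in atTop, 0 < g x) (hβ0 : 0 < β) (hβ : α < β)
    (hg : Tendsto (fun x => g (2 * x) / g x) atTop (𝓝 (2 ^ (-α)))) :
    ∃ K > 0, (∀ x, K ≤ x → 0 < g x) ∧
      ∀ x, K ≤ x → ∀ a, 1 ≤ a → g x ≤ (2 * a) ^ β * g (a * x) := by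
  have h2 : (2 : ℝ) ^ (-β) < 2 ^ (-α) :=
    Real.rpow_lt_rpow_of_exponent_lt one_lt_two (by linarith)
  obtain ⟨K, hK⟩ := eventually_atTop.1
    ((hpos.and (hg.eventually_const_lt h2)).and (eventually_gt_atTop 0))
  have hK0 : 0 < K := (hK K le_rfl).2
  have hstep : ∀ x, K ≤ x → g x ≤ 2 ^ β * g (2 * x) := by
    intro x hx
    obtain ⟨⟨hgx, h⟩, -⟩ := hK x hx
    rw [lt_div_iff₀ hgx, Real.rpow_neg zero_le_two] at h
    have h2β : (0 : ℝ) < 2 ^ β := by positivity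
    rw [inv_mul_lt_iff₀ h2β] at h
    exact h.le
  have hiter : ∀ n : ℕ, ∀ x, K ≤ x → g x ≤ ((2 : ℝ) ^ n) ^ β * g (2 ^ n * x) := by
    intro n
    induction n with
    | zero => intro x _; simp
    | succ n ih =>
      intro x hx
      have h1 : (1 : ℝ) ≤ 2 ^ n := one_le_pow₀ one_le_two
      have hx' : K ≤ 2 ^ n * x := by nlinarith
      calc g x ≤ ((2 : ℝ) ^ n) ^ β * g (2 ^ n * x) := ih x hx
        _ ≤ ((2 : ℝ) ^ n) ^ β * (2 ^ β * g (2 * (2 ^ n * x))) := by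
          gcongr
          exact hstep _ hx'
        _ = ((2 : ℝ) ^ (n + 1)) ^ β * g (2 ^ (n + 1) * x) := by
          rw [pow_succ, Real.mul_rpow (by positivity) zero_le_two]
          ring_nf
  refine ⟨K, hK0, fun x hx => (hK x hx).1.1, fun x hx a ha => ?_⟩
  obtain ⟨n, hn1, hn2⟩ := exists_nat_pow_near ha one_lt_two
  have hx0 : 0 < x := hK0.trans_le hx
  have hax : K ≤ a * x := by nlinarith
  have hgax := (hK _ hax).1.1
  calc g x ≤ ((2 : ℝ) ^ (n + 1)) ^ β * g (2 ^ (n + 1) * x) := hiter _ x hx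
    _ ≤ ((2 : ℝ) ^ (n + 1)) ^ β * g (a * x) := by
      gcongr
      exact hanti (by gcongr)
    _ ≤ (2 * a) ^ β * g (a * x) := by
      have : (2 : ℝ) ^ (n + 1) ≤ 2 * a := by rw [pow_succ]; linarith
      gcongr

lemma Antitone.exists_potter_bound_div {g : ℝ → ℝ} {α β : ℝ} (hanti : Antitone g)
    (hpos : ∀ᶠ x in atTop, 0 < g x) (hβ0 : 0 < β) (hβ : α < β)
    (hg : Tendsto (fun x => g (2 * x) / g x) atTop (𝓝 (2 ^ (-α)))) :
    ∃ K > 0, ∀ t a, 0 < a → 0 ≤ g t → K ≤ t / a → g (t / a) ≤ (1 + (2 * a) ^ β) * g t := by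
  obtain ⟨K, hK0, -, hK⟩ := hanti.exists_potter_bound hpos hβ0 hβ hg
  refine ⟨K, hK0, fun t a ha hgt hta => ?_⟩
  have h2a : 0 ≤ (2 * a) ^ β := by positivity
  have ht : 0 < t := by
    have := hK0.trans_le hta
    exact (div_pos_iff_of_pos_right ha).1 this
  rcases le_total 1 a with h1 | h1
  · have := hK _ hta a h1
    rw [mul_div_cancel₀ _ ha.ne'] at this
    linarith
  · have : g (t / a) ≤ g t := hanti ((le_div_iff₀ ha).2 (by nlinarith))
    nlinarith [mul_nonneg h2a hgt]

lemma Antitone.rpow_neg_isLittleO {g : ℝ → ℝ} {α γ : ℝ} (hanti : Antitone g)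
    (hpos : ∀ᶠ x in atTop, 0 < g x) (hα : 0 < α) (hγ : α < γ)
    (hg : Tendsto (fun x => g (2 * x) / g x) atTop (𝓝 (2 ^ (-α)))) :
    (fun t : ℝ => t ^ (-γ)) =o[atTop] g := by
  obtain ⟨β, hαβ, hβγ⟩ := exists_between hγ
  obtain ⟨K, hK0, hKpos, hK⟩ := hanti.exists_potter_bound hpos (hα.trans hαβ) hαβ hg
  have h1 : (fun t : ℝ => t ^ (-γ)) =o[atTop] fun t : ℝ => t ^ (-β) :=
    by
    refine (isLittleO_iff_tendsto' ?_).2 ?_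
    · filter_upwards [eventually_gt_atTop 0] with t ht h
      exact absurd h (Real.rpow_pos_of_pos ht _).ne'
    · refine (tendsto_rpow_neg_atTop (sub_pos.2 hβγ)).congr' ?_
      filter_upwards [eventually_gt_atTop 0] with t ht
      rw [← Real.rpow_sub ht]
      ring_nf
  refine h1.trans_isBigO (IsBigO.of_bound ((2 / K) ^ β / g K) ?_)
  filter_upwards [eventually_ge_atTop K] with t ht
  have ht0 : 0 < t := hK0.trans_le ht
  have hgt := hKpos t ht
  have hgK := hKpos K le_rfl
  have := hK K le_rfl (t / K) ((one_le_div hK0).2 ht)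
  rw [div_mul_cancel₀ _ hK0.ne', show 2 * (t / K) = 2 / K * t by ring,
    Real.mul_rpow (by positivity) ht0.le] at this
  rw [Real.norm_of_nonneg (by positivity), Real.norm_of_nonneg hgt.le, Real.rpow_neg ht0.le,
    inv_eq_one_div, div_mul_eq_mul_div, div_le_div_iff₀ (by positivity) hgK]
  linarith

section Probability

variable {Ω : Type*} [MeasurableSpace Ω] {μ : Measure Ω}

lemma antitone_tail [IsFiniteMeasure μ] (Y : Ω → ℝ) :
    Antitone fun t => (μ {ω | t < Y ω}).toReal := fun _ _ h =>
  ENNReal.toReal_mono (measure_ne_top _ _) (measure_mono fun _ hω => lt_of_le_of_lt h hω)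

/-- A random variable with a finite moment of order `γ` has tail `O(t ^ (-γ))`. -/
lemma tail_isBigO_rpow_neg [IsFiniteMeasure μ] {Y : Ω → ℝ} (hY : Measurable Y) {γ : ℝ}
    (hγ : 0 < γ) (hmom : ∫⁻ ω, ENNReal.ofReal (|Y ω| ^ γ) ∂μ < ⊤) {M : ℝ} (hM : 0 < M) :
    (fun t : ℝ => (μ {ω | t / M < |Y ω|}).toReal) =O[atTop] fun t : ℝ => t ^ (-γ) := by
  refine IsBigO.of_bound ((∫⁻ ω, ENNReal.ofReal (|Y ω| ^ γ) ∂μ).toReal * M ^ γ) ?_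
  filter_upwards [eventually_gt_atTop 0] with t ht
  have htM : 0 < (t / M) ^ γ := by positivity
  have h1 := mul_meas_ge_le_lintegral (μ := μ) (f := fun ω => ENNReal.ofReal (|Y ω| ^ γ))
    (by fun_prop) (ENNReal.ofReal ((t / M) ^ γ))
  have h2 : μ {ω | t / M < |Y ω|} ≤
      μ {ω | ENNReal.ofReal ((t / M) ^ γ) ≤ ENNReal.ofReal (|Y ω| ^ γ)} := by
    refine measure_mono fun ω hω => ENNReal.ofReal_le_ofReal ?_
    exact Real.rpow_le_rpow (by positivity) (le_of_lt hω) hγ.le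
  have h3 := ENNReal.toReal_mono hmom.ne ((mul_le_mul_right h2 _).trans h1)
  rw [ENNReal.toReal_mul, ENNReal.toReal_ofReal htM.le, Real.div_rpow ht.le hM.le,
    div_mul_eq_mul_div, div_le_iff₀ (by positivity)] at h3
  rw [Real.norm_of_nonneg ENNReal.toReal_nonneg, Real.norm_of_nonneg (by positivity),
    Real.rpow_neg ht.le, ← div_eq_mul_inv, le_div_iff₀ (by positivity)]
  linarith

lemma ProbabilityTheory.IndepFun.measure_eq_lintegral [IsFiniteMeasure μ] {X A : Ω → ℝ}
    (hX : Measurable X) (hA : Measurable A) (h : IndepFun X A μ) {S : Set (ℝ × ℝ)}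
    (hS : MeasurableSet S) :
    μ {ω | (X ω, A ω) ∈ S} = ∫⁻ ω, μ {ω' | (X ω', A ω) ∈ S} ∂μ := by
  have h1 := (indepFun_iff_map_prod_eq_prod_map_map hX.aemeasurable hA.aemeasurable).1 h
  have h2 : μ {ω | (X ω, A ω) ∈ S} = (μ.map fun ω => (X ω, A ω)) S :=
    (Measure.map_apply (hX.prodMk hA) hS).symm
  rw [h2, h1, Measure.prod_apply_symm hS, lintegral_map (measurable_measure_prodMk_right hS) hA]
  refine lintegral_congr fun ω => ?_
  rw [Measure.map_apply hX (measurable_prodMk_right hS)]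
  rfl

/-- Joint exceedances of `A * X` and `B` are negligible with respect to the tail of `B`. -/
lemma eventually_joint_tail_le [IsFiniteMeasure μ] {A B X : Ω → ℝ}
    (hX : Measurable X) {g : ℝ → ℝ}
    (hA : ∀ M > 0, (fun t : ℝ => (μ {ω | t / M < |A ω|}).toReal) =o[atTop] g)
    (hB : ∀ κ > 0, (fun t : ℝ => (μ {ω | κ * t ≤ |B ω|}).toReal) =O[atTop] g)
    (hpos : ∀ᶠ t in atTop, 0 < g t)
    (hindep : IndepFun X B μ) {κ δ : ℝ} (hκ : 0 < κ) (hδ : 0 < δ) :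
    ∀ᶠ t in atTop, (μ {ω | κ * t ≤ |A ω * X ω| ∧ κ * t ≤ |B ω|}).toReal ≤ δ * g t := by
  obtain ⟨C, hC0, hC⟩ := (hB κ hκ).exists_pos
  have hlim : Tendsto (fun M : ℝ => (μ {ω | κ * M ≤ |X ω|}).toReal) atTop (𝓝 0) := by
    have h0 : Tendsto (fun M : ℝ => μ {ω | κ * M ≤ |X ω|}) atTop
        (𝓝 (μ (⋂ M : ℝ, {ω | κ * M ≤ |X ω|}))) := by
      refine tendsto_measure_iInter_atTop
        (fun M => (measurableSet_le measurable_const (by fun_prop)).nullMeasurableSet) ?_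
        ⟨0, measure_ne_top _ _⟩
      intro M N hMN ω hω
      exact (mul_le_mul_of_nonneg_left hMN hκ.le).trans hω
    have hempty : (⋂ M : ℝ, {ω | κ * M ≤ |X ω|}) = ∅ := by
      refine Set.eq_empty_iff_forall_notMem.2 fun ω hω => ?_
      have := Set.mem_iInter.1 hω ((|X ω| + 1) / κ)
      simp only [Set.mem_ofPred_eq] at this
      rw [mul_div_cancel₀ _ hκ.ne'] at this
      linarith
    rw [hempty, measure_empty] at h0
    exact (ENNReal.tendsto_toReal ENNReal.zero_ne_top).comp h0
  obtain ⟨M, hM0, hM⟩ := ((eventually_gt_atTop (0 : ℝ)).and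
    (hlim.eventually_lt_const (show 0 < δ / (2 * C) by positivity))).exists
  filter_upwards [hC.bound, (hA M hM0).def (half_pos hδ), hpos, eventually_gt_atTop 0]
    with t hBt hAt hgt ht
  rw [Real.norm_of_nonneg ENNReal.toReal_nonneg, Real.norm_of_nonneg hgt.le] at hBt hAt
  have hsub : {ω | κ * t ≤ |A ω * X ω| ∧ κ * t ≤ |B ω|} ⊆
      {ω | t / M < |A ω|} ∪ (X ⁻¹' {x | κ * M ≤ |x|} ∩ B ⁻¹' {b | κ * t ≤ |b|}) := by
    rintro ω ⟨h1, h2⟩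
    by_cases hAω : t / M < |A ω|
    · exact Or.inl hAω
    · refine Or.inr ⟨?_, h2⟩
      have hAM : |A ω| * M ≤ t := (le_div_iff₀ hM0).1 (not_lt.1 hAω)
      by_contra hcon
      have hcon' : |X ω| < κ * M := not_le.1 hcon
      rw [abs_mul] at h1
      have hA0 : 0 < |A ω| := by
        rcases (abs_nonneg (A ω)).eq_or_lt with h | h
        · rw [← h, zero_mul] at h1
          nlinarith
        · exact h
      nlinarith [mul_lt_mul_of_pos_left hcon' hA0]
  have hprod := hindep.measure_inter_preimage_eq_mul {x | κ * M ≤ |x|} {b | κ * t ≤ |b|}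
    (measurableSet_le measurable_const (by fun_prop))
    (measurableSet_le measurable_const (by fun_prop))
  have h1 := (measure_mono (μ := μ) hsub).trans (measure_union_le _ _)
  rw [hprod] at h1
  have h2 := ENNReal.toReal_mono (by finiteness) h1
  rw [ENNReal.toReal_add (by finiteness) (by finiteness), ENNReal.toReal_mul] at h2
  refine h2.trans ?_
  calc _ ≤ δ / 2 * g t + δ / (2 * C) * (C * g t) :=
        add_le_add hAt (mul_le_mul hM.le hBt ENNReal.toReal_nonneg (by positivity))
    _ = δ * g t := by field_simp; norm_num

/-- A comparison between tails of `X` transfers to the tails of `A * X`. -/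
lemma eventually_tail_mul_le [IsProbabilityMeasure μ] {A X : Ω → ℝ} (hA : Measurable A)
    (hX : Measurable X) (hApos : ∀ᵐ ω ∂μ, 0 < A ω) (hindep : IndepFun X A μ) {β K₀ : ℝ}
    (hK₀ : 0 < K₀) (hmom : ∫⁻ ω, ENNReal.ofReal (|A ω| ^ β) ∂μ < ⊤) {g : ℝ → ℝ}
    (hpos : ∀ᶠ t in atTop, 0 < g t)
    (hAg : ∀ M > 0, (fun t : ℝ => (μ {ω | t / M < |A ω|}).toReal) =o[atTop] g)
    (hpot : ∀ t a, 0 < a → 0 ≤ g t → K₀ ≤ t / a → g (t / a) ≤ (1 + (2 * a) ^ β) * g t)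
    {c η : ℝ} (hη : 0 < η)
    (hc : ∀ᶠ x in atTop,
      (μ {ω | c * x < X ω}).toReal ≤ (1 + η) * (μ {ω | x < X ω}).toReal + η * g x) :
    ∀ᶠ t in atTop, (μ {ω | c * t < A ω * X ω}).toReal ≤
      (1 + η) * (μ {ω | t < A ω * X ω}).toReal +
        η * (2 + 2 ^ β * (∫⁻ ω, ENNReal.ofReal (|A ω| ^ β) ∂μ).toReal) * g t := by
  obtain ⟨K, hK⟩ := eventually_atTop.1 (hc.and (eventually_ge_atTop K₀))
  have hK0 : 0 < K := hK₀.trans_le (hK K le_rfl).2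
  filter_upwards [hpos, (hAg K hK0).def hη] with t hgt hAt
  rw [Real.norm_of_nonneg ENNReal.toReal_nonneg, Real.norm_of_nonneg hgt.le] at hAt
  have hrep : ∀ s : ℝ, μ {ω | s < A ω * X ω} = ∫⁻ ω, μ {ω' | s < A ω * X ω'} ∂μ := fun s =>
    hindep.measure_eq_lintegral hX hA (S := {q | s < q.2 * q.1})
      (measurableSet_lt measurable_const (by fun_prop))
  have hrepK : μ {ω | c * t < A ω * X ω ∧ A ω ≤ t / K} =
      ∫⁻ ω, μ {ω' | c * t < A ω * X ω' ∧ A ω ≤ t / K} ∂μ :=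
    hindep.measure_eq_lintegral hX hA (S := {q | c * t < q.2 * q.1 ∧ q.2 ≤ t / K})
      (by
        rw [Set.ofPred_and]
        exact (measurableSet_lt measurable_const (by fun_prop)).inter
          (measurableSet_le (by fun_prop) measurable_const))
  have hpt : ∀ᵐ ω ∂μ, μ {ω' | c * t < A ω * X ω' ∧ A ω ≤ t / K} ≤
      ENNReal.ofReal (1 + η) * μ {ω' | t < A ω * X ω'} + ENNReal.ofReal (η * g t) *
        (1 + ENNReal.ofReal (2 ^ β) * ENNReal.ofReal (|A ω| ^ β)) := by
    filter_upwards [hApos] with ω ha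
    by_cases hat : A ω ≤ t / K
    · have hta : K ≤ t / A ω := by
        rw [le_div_iff₀ hK0] at hat
        rw [le_div_iff₀ ha]
        linarith
      have h1 := (hK _ hta).1
      have h2 := hpot t _ ha hgt.le ((hK K le_rfl).2.trans hta)
      have e1 : {ω' | c * t < A ω * X ω' ∧ A ω ≤ t / K} = {ω' | c * (t / A ω) < X ω'} := by
        ext ω'
        simp only [Set.mem_ofPred_eq, hat, and_true]
        rw [← mul_div_assoc, div_lt_iff₀ ha, mul_comm (X ω')]
      have e2 : {ω' | t < A ω * X ω'} = {ω' | t / A ω < X ω'} := by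
        ext ω'
        simp only [Set.mem_ofPred_eq]
        rw [div_lt_iff₀ ha, mul_comm (X ω')]
      rw [e1, e2, ← ENNReal.ofReal_toReal (measure_ne_top μ {ω' | c * (t / A ω) < X ω'}),
        ← ENNReal.ofReal_toReal (measure_ne_top μ {ω' | t / A ω < X ω'}), abs_of_pos ha,
        ← ENNReal.ofReal_mul (by positivity), ← ENNReal.ofReal_mul (by positivity),
        ← ENNReal.ofReal_one, ← ENNReal.ofReal_add zero_le_one (by positivity),
        ← ENNReal.ofReal_mul (by positivity), ← ENNReal.ofReal_add (by positivity) (by positivity),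
        ← Real.mul_rpow zero_le_two ha.le]
      refine ENNReal.ofReal_le_ofReal (h1.trans ?_)
      nlinarith
    · simp [hat]
  have hbound : μ {ω | c * t < A ω * X ω ∧ A ω ≤ t / K} ≤
      ENNReal.ofReal (1 + η) * μ {ω | t < A ω * X ω} + ENNReal.ofReal (η * g t) *
        (1 + ENNReal.ofReal (2 ^ β) * ∫⁻ ω, ENNReal.ofReal (|A ω| ^ β) ∂μ) := by
    rw [hrepK, hrep t]
    refine (lintegral_mono_ae hpt).trans_eq ?_
    rw [lintegral_add_right _ (by fun_prop), lintegral_const_mul' _ _ ENNReal.ofReal_ne_top,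
      lintegral_const_mul' _ _ ENNReal.ofReal_ne_top, lintegral_add_left measurable_const,
      lintegral_const_mul' _ _ ENNReal.ofReal_ne_top, lintegral_const, measure_univ, one_mul]
  have hsub : {ω | c * t < A ω * X ω} ⊆
      {ω | t / K < |A ω|} ∪ {ω | c * t < A ω * X ω ∧ A ω ≤ t / K} := by
    intro ω hω
    by_cases h : A ω ≤ t / K
    · exact Or.inr ⟨hω, h⟩
    · exact Or.inl ((not_le.1 h).trans_le (le_abs_self _))
  have h1 := ((measure_mono (μ := μ) hsub).trans (measure_union_le _ _)).trans
    (add_le_add_right hbound _)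
  have hm := hmom.ne
  have h2 := ENNReal.toReal_mono (by finiteness) h1
  rw [ENNReal.toReal_add (by finiteness) (by finiteness),
    ENNReal.toReal_add (by finiteness) (by finiteness), ENNReal.toReal_mul, ENNReal.toReal_mul,
    ENNReal.toReal_add (by finiteness) (by finiteness), ENNReal.toReal_mul,
    ENNReal.toReal_ofReal (by positivity), ENNReal.toReal_ofReal (by positivity),
    ENNReal.toReal_ofReal (by positivity), ENNReal.toReal_one] at h2
  refine h2.trans ?_
  linarith

/-- If the joint exceedances of `Y` and `B` are negligible and the sum of their tails is stable
under multiplication of the argument by constants close to `1`, then the tail of `Y + B` is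
equivalent to that sum. -/
lemma tendsto_tail_add_div [IsFiniteMeasure μ] {Y B : Ω → ℝ}
    (hB : Measurable B) (hpos : ∀ᶠ t in atTop, 0 < (μ {ω | t < B ω}).toReal)
    (hjoint : ∀ κ > 0, ∀ δ > 0, ∀ᶠ t in atTop,
      (μ {ω | κ * t ≤ |Y ω| ∧ κ * t ≤ |B ω|}).toReal ≤ δ * (μ {ω | t < B ω}).toReal)
    (hstable : ∀ δ > 0, ∀ᶠ c in 𝓝[<] (1 : ℝ), ∀ᶠ t in atTop,
      (μ {ω | c * t < Y ω}).toReal + (μ {ω | c * t < B ω}).toReal ≤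
        (1 + δ) * ((μ {ω | t < Y ω}).toReal + (μ {ω | t < B ω}).toReal)) :
    Tendsto (fun t => (μ {ω | t < Y ω + B ω}).toReal /
      ((μ {ω | t < Y ω}).toReal + (μ {ω | t < B ω}).toReal)) atTop (𝓝 1) := by
  rw [Metric.tendsto_nhds]
  intro ε hε
  obtain ⟨c, hc, hc0, hc1⟩ := ((hstable (ε / 4) (by positivity)).and
    ((eventually_nhdsWithin_of_eventually_nhds (lt_mem_nhds (zero_lt_one' ℝ))).and
      (eventually_mem_nhdsWithin (s := Set.Iio 1)))).exists
  rw [Set.mem_Iio] at hc1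
  have hc' : 0 < 1 - c := sub_pos.2 hc1
  have hinv : Tendsto (fun t : ℝ => t / c) atTop atTop := tendsto_id.atTop_div_const hc0
  filter_upwards [hc, hinv.eventually hc, hpos, eventually_gt_atTop 0,
    hjoint (1 - c) hc' (ε / 8) (by positivity)] with t h1 h2 hgt ht hj
  rw [mul_div_cancel₀ _ hc0.ne'] at h2
  set J := {ω | (1 - c) * t ≤ |Y ω| ∧ (1 - c) * t ≤ |B ω|}
  have hupper : {ω | t < Y ω + B ω} ⊆
      ({ω | c * t < Y ω} ∪ {ω | c * t < B ω}) ∪ J := by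
    intro ω hω
    by_contra hcon
    simp only [Set.mem_union, Set.mem_ofPred_eq, not_or, not_lt, J] at hcon hω
    obtain ⟨⟨hY, hBω⟩, hJ⟩ := hcon
    exact hJ ⟨(by linarith : (1 - c) * t ≤ Y ω).trans (le_abs_self _),
      (by linarith : (1 - c) * t ≤ B ω).trans (le_abs_self _)⟩
  have hs : t + (1 - c) * t ≤ t / c := by
    rw [le_div_iff₀ hc0]
    nlinarith [mul_nonneg ht.le (sq_nonneg (1 - c))]
  have hct : 0 < (1 - c) * t := mul_pos hc' ht
  have hlower : {ω | t / c < Y ω} ∪ {ω | t / c < B ω} ⊆ {ω | t < Y ω + B ω} ∪ J := by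
    rintro ω (hω | hω)
    · rw [Set.mem_ofPred_eq] at hω
      by_cases h : t < Y ω + B ω
      · exact Or.inl h
      · refine Or.inr ⟨le_trans ?_ (le_abs_self _), le_trans ?_ (neg_le_abs _)⟩ <;> linarith
    · rw [Set.mem_ofPred_eq] at hω
      by_cases h : t < Y ω + B ω
      · exact Or.inl h
      · refine Or.inr ⟨le_trans ?_ (neg_le_abs _), le_trans ?_ (le_abs_self _)⟩ <;> linarith
  have hinter : {ω | t / c < Y ω} ∩ {ω | t / c < B ω} ⊆ J := by
    rintro ω ⟨hY, hBω⟩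
    rw [Set.mem_ofPred_eq] at hY hBω
    refine ⟨le_trans ?_ (le_abs_self _), le_trans ?_ (le_abs_self _)⟩ <;> linarith
  have hup : μ.real {ω | t < Y ω + B ω} ≤
      μ.real {ω | c * t < Y ω} + μ.real {ω | c * t < B ω} + μ.real J :=
    (measureReal_mono hupper).trans ((measureReal_union_le _ _).trans
      (add_le_add_left (measureReal_union_le _ _) _))
  have hlow : μ.real {ω | t / c < Y ω} + μ.real {ω | t / c < B ω} ≤
      μ.real {ω | t < Y ω + B ω} + 2 * μ.real J := by
    rw [← measureReal_union_add_inter (measurableSet_lt measurable_const hB)]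
    linarith [measureReal_mono (μ := μ) hinter,
      (measureReal_mono (μ := μ) hlower).trans (measureReal_union_le _ _)]
  simp only [Measure.real] at hup hlow
  have hY0 : 0 ≤ (μ {ω | t < Y ω}).toReal := ENNReal.toReal_nonneg
  generalize (μ {ω | t < Y ω}).toReal = R at *
  generalize (μ {ω | t < B ω}).toReal = G at *
  have hS : 0 < R + G := by linarith
  rw [Real.dist_eq, abs_lt, lt_sub_iff_add_lt, sub_lt_iff_lt_add, lt_div_iff₀ hS, div_lt_iff₀ hS]
  constructor
  · by_contra! hT
    have hεR : 0 ≤ ε * R := by positivity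
    have h3 : (μ {ω | t / c < Y ω}).toReal + (μ {ω | t / c < B ω}).toReal ≤
        (1 - 3 * ε / 4) * (R + G) := by linarith
    have h4 := h2.trans (mul_le_mul_of_nonneg_left h3 (by positivity : 0 ≤ 1 + ε / 4))
    nlinarith [mul_pos hε hS, mul_pos (mul_pos hε hε) hS]
  · nlinarith

end Probability

/-- If `(A,B)` satisfies the Grey assumption with index `α > 0`, `A > 0`
a.s., and `X ⟂ (A,B)` is either regularly varying or has a tail negligible relative to
that of `B`, then `ℙ(AX + B > t) ~ ℙ(AX > t) + ℙ(B > t)` as `t → ∞`. -/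
theorem stmt8
    {Ω : Type*} [MeasurableSpace Ω] (μ : Measure Ω) [IsProbabilityMeasure μ]
    (A B X : Ω → ℝ) (hA : Measurable A) (hB : Measurable B) (hX : Measurable X)
    (hApos : ∀ᵐ ω ∂μ, 0 < A ω)
    (α : ℝ) (hα : 0 < α) (hGrey : GreyAssumption μ A B α)
    (hindep : IndepFun X (fun ω => (A ω, B ω)) μ)
    (hXtail : (∃ θ > 0, RegularlyVaryingTail μ X θ) ∨
      (fun t => (μ {ω | t < X ω}).toReal) =o[atTop]
        fun t => (μ {ω | t < B ω}).toReal) :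
    Tendsto (fun t =>
        (μ {ω | t < A ω * X ω + B ω}).toReal /
          ((μ {ω | t < A ω * X ω}).toReal + (μ {ω | t < B ω}).toReal))
      atTop (𝓝 1) := by
  obtain ⟨⟨ν, hν, -, hmom⟩, p, q, l, hp, -, -, hl, hBp, hBq⟩ := hGrey
  set G : ℝ → ℝ := fun t => (μ {ω | t < B ω}).toReal with hG
  have hanti : Antitone G := antitone_tail B
  have hpos : ∀ᶠ t in atTop, 0 < G t := hl.tail_pos hp hBp
  have hratio : ∀ c > 0, Tendsto (fun x => G (c * x) / G x) atTop (𝓝 (c ^ (-α))) :=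
    fun c hc => hl.tendsto_tail_ratio hp hBp hc
  have hαν : α < α + ν := by linarith
  have hαν0 : 0 < α + ν := by linarith
  have hAG : ∀ M > 0, (fun t : ℝ => (μ {ω | t / M < |A ω|}).toReal) =o[atTop] G :=
    fun M hM => (tail_isBigO_rpow_neg hA hαν0 hmom hM).trans_isLittleO
      (hanti.rpow_neg_isLittleO hpos hα hαν (hratio 2 two_pos))
  obtain ⟨K₀, hK₀, hpot⟩ := hanti.exists_potter_bound_div hpos hαν0 hαν (hratio 2 two_pos)
  have hindA : IndepFun X A μ := hindep.comp measurable_id measurable_fst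
  have hindB : IndepFun X B μ := hindep.comp measurable_id measurable_snd
  have hscale : ∀ c > 0, (fun t => G (c * t)) =O[atTop] G := fun c hc =>
    isBigO_of_div_tendsto_nhds (hpos.mono fun t ht h => absurd h ht.ne') _ (hratio c hc)
  have hneg : (fun t => (μ {ω | t < -B ω}).toReal) =O[atTop] G := by
    refine isBigO_of_div_tendsto_nhds (hpos.mono fun t ht h => absurd h ht.ne') (q / p) ?_
    refine (hBq.div hBp hp.ne').congr' ?_
    filter_upwards [eventually_gt_atTop 0] with t ht
    have := hl.2.1 t ht
    exact div_div_div_cancel_right₀ (by positivity) _ _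
  have hBabs : ∀ κ > 0, (fun t : ℝ => (μ {ω | κ * t ≤ |B ω|}).toReal) =O[atTop] G := by
    intro κ hκ
    have hκ2 : 0 < κ / 2 := half_pos hκ
    have h1 := (hscale (κ / 2) hκ2).add ((hneg.comp_tendsto
      (tendsto_id.const_mul_atTop hκ2)).trans (hscale (κ / 2) hκ2))
    refine IsBigO.trans (IsBigO.of_bound 1 ?_) h1
    filter_upwards [eventually_gt_atTop 0] with t ht
    have hsub : {ω | κ * t ≤ |B ω|} ⊆ {ω | κ / 2 * t < B ω} ∪ {ω | κ / 2 * t < -B ω} := by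
      intro ω hω
      rw [Set.mem_ofPred_eq] at hω
      have hκt : κ / 2 * t < κ * t := by nlinarith
      exact lt_abs.1 (hκt.trans_le hω)
    have h2 := (measureReal_mono (μ := μ) hsub).trans (measureReal_union_le _ _)
    rw [one_mul, Real.norm_of_nonneg ENNReal.toReal_nonneg]
    exact h2.trans (le_abs_self _)
  have hXstable : ∀ δ > 0, ∀ᶠ c in 𝓝[<] (1 : ℝ), ∀ᶠ x in atTop,
      (μ {ω | c * x < X ω}).toReal ≤ (1 + δ) * (μ {ω | x < X ω}).toReal + δ * G x := by
    intro δ hδ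
    rcases hXtail with ⟨θ, -, L, hL, hXL⟩ | ho
    · have h1 : Tendsto (fun x => (μ {ω | x < X ω}).toReal / (x ^ (-θ) * L x)) atTop (𝓝 1) := by
        refine tendsto_const_nhds.congr' ?_
        filter_upwards [hXL, eventually_gt_atTop 0] with x hx hx0
        have := hL.2.1 x hx0
        rw [hx, div_self (by positivity)]
      filter_upwards [eventually_le_of_tendsto_ratio
        (g := fun x => (μ {ω | x < X ω}).toReal) (hL.tail_pos one_pos h1)
        (fun c hc => hL.tendsto_tail_ratio one_pos h1 hc) hδ] with c hc
      filter_upwards [hc, hpos] with x hx hgx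
      nlinarith
    · filter_upwards [eventually_le_of_tendsto_ratio hpos hratio one_pos,
        eventually_nhdsWithin_of_eventually_nhds (lt_mem_nhds (zero_lt_one' ℝ))] with c hc hc0
      have hcx : Tendsto (fun x : ℝ => c * x) atTop atTop := tendsto_id.const_mul_atTop hc0
      filter_upwards [hc, hcx.eventually (ho.def (half_pos hδ))] with x hx hx'
      rw [Real.norm_of_nonneg ENNReal.toReal_nonneg,
        Real.norm_of_nonneg ENNReal.toReal_nonneg] at hx'
      have hX0 : 0 ≤ (μ {ω | x < X ω}).toReal := ENNReal.toReal_nonneg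
      have : 0 ≤ (1 + δ) * (μ {ω | x < X ω}).toReal := by positivity
      have := mul_le_mul_of_nonneg_left hx (half_pos hδ).le
      simp only [hG] at *
      linarith
  refine tendsto_tail_add_div hB hpos
    (fun κ hκ δ hδ => eventually_joint_tail_le hX hAG hBabs hpos hindB hκ hδ) ?_
  intro δ hδ
  set D : ℝ := 2 + 2 ^ (α + ν) * (∫⁻ ω, ENNReal.ofReal (|A ω| ^ (α + ν)) ∂μ).toReal with hD
  have hD2 : 2 ≤ D := le_add_of_nonneg_right (by positivity)
  have hη : 0 < δ / (2 * D) := by positivity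
  have hηδ : δ / (2 * D) ≤ δ := div_le_self hδ.le (by linarith)
  filter_upwards [hXstable _ hη, eventually_le_of_tendsto_ratio hpos hratio (half_pos hδ)]
    with c hcX hcG
  filter_upwards [eventually_tail_mul_le hA hX hApos hindA hK₀ hmom hpos hAG hpot hη hcX, hcG]
    with t h1 h2
  have h3 : δ / (2 * D) * D = δ / 2 := by field_simp
  rw [← hD, h3] at h1
  have hR : 0 ≤ (μ {ω | t < A ω * X ω}).toReal := ENNReal.toReal_nonneg
  have := mul_le_mul_of_nonneg_right hηδ hR
  simp only [hG] at *
  linarith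
end

section
/- Let A₁, A₂, A₃ be positive random variables and B a real random variable such that each of the pairs (A₁, B), (A₂, B), (A₃, B) satisfies the Grey assumption with the same index α > 0, and let (X, Y, Z) be real random variables independent of (A₁, A₂, A₃, B) such that, writing Q := A₁X + A₂Y + A₃Z, either Q is regularly varying with some tail index θ > 0 or ℙ(Q > t) = o(ℙ(B > t)) as t → ∞. Then ℙ(A₁X + A₂Y + A₃Z + B > t) ~ ℙ(A₁X + A₂Y + A₃Z > t) + ℙ(B > t) as t → ∞. -/
open MeasureTheory Filter ProbabilityTheory Asymptotics
open scoped Topology ENNReal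

/-- Two functions comparable to the same regularly varying function have a limiting ratio
after rescaling the argument of one of them. -/
lemma SlowlyVarying.tendsto_comp_mul_div {l f g : ℝ → ℝ} {θ p q : ℝ} (hl : SlowlyVarying l)
    (hp : p ≠ 0) (hf : Tendsto (fun x => f x / (x ^ (-θ) * l x)) atTop (𝓝 p))
    (hg : Tendsto (fun x => g x / (x ^ (-θ) * l x)) atTop (𝓝 q)) {c : ℝ} (hc : 0 < c) :
    Tendsto (fun x => g (c * x) / f x) atTop (𝓝 (q / p * c ^ (-θ))) := by
  have hcx : Tendsto (fun x : ℝ => c * x) atTop atTop := tendsto_id.const_mul_atTop hc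
  have h1 := (((hg.comp hcx).mul (hl.2.2 c hc)).mul_const (c ^ (-θ))).div hf hp
  have h2 : q * 1 * c ^ (-θ) / p = q / p * c ^ (-θ) := by ring
  rw [h2] at h1
  refine h1.congr' ?_
  filter_upwards [eventually_gt_atTop 0] with x hx
  have hlx := (hl.2.1 x hx).ne'
  have hlcx := (hl.2.1 (c * x) (mul_pos hc hx)).ne'
  have hx' := (Real.rpow_pos_of_pos hx (-θ)).ne'
  have hc' := (Real.rpow_pos_of_pos hc (-θ)).ne'
  simp only [Pi.div_apply, Function.comp_apply]
  rw [Real.mul_rpow hc.le hx.le]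
  by_cases hfx : f x = 0
  · simp [hfx]
  · field_simp

/-- A nonnegative antitone function whose dyadic ratio tends to `2 ^ (-α)` decays more slowly
than every power `t ^ (-s)` with `α < s`. -/
lemma Antitone.rpow_neg_div_tendsto_zero {f : ℝ → ℝ} (hf : Antitone f)
    (hpos : ∀ x, 0 < f x) {α s : ℝ} (hs0 : 0 < s) (hs : α < s)
    (h : Tendsto (fun x => f (2 * x) / f x) atTop (𝓝 (2 ^ (-α)))) :
    Tendsto (fun x => x ^ (-s) / f x) atTop (𝓝 0) := by
  obtain ⟨u, hu1, hus⟩ : ∃ u, α < u ∧ u < s := exists_between hs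
  have hlt : (2 : ℝ) ^ (-u) < 2 ^ (-α) :=
    Real.rpow_lt_rpow_of_exponent_lt (by norm_num) (by linarith)
  obtain ⟨T, hT⟩ := eventually_atTop.1
    ((h.eventually (lt_mem_nhds hlt)).and (eventually_gt_atTop (0 : ℝ)))
  have hT0 : 0 < T := (hT T le_rfl).2
  set r : ℝ := 2 ^ (s - u) with hr
  have hr1 : 1 < r := Real.one_lt_rpow (by norm_num) (by linarith)
  set k : ℝ := T ^ s * f (2 * T) with hk
  have hk0 : 0 < k := mul_pos (Real.rpow_pos_of_pos hT0 _) (hpos _)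
  have key : ∀ n : ℕ, ∀ t, 2 ^ n * T ≤ t → t ≤ 2 ^ (n + 1) * T → k * r ^ n ≤ t ^ s * f t := by
    intro n
    induction n with
    | zero =>
      intro t h1 h2
      simp only [pow_zero, one_mul, zero_add, pow_one, mul_one] at h1 h2 ⊢
      exact mul_le_mul (Real.rpow_le_rpow hT0.le h1 hs0.le) (hf h2) (hpos _).le
        (Real.rpow_nonneg (hT0.le.trans h1) _)
    | succ n ih =>
      intro t h1 h2
      have h1' : 2 ^ n * T ≤ t / 2 := by rw [pow_succ] at h1; linarith
      have h2' : t / 2 ≤ 2 ^ (n + 1) * T := by rw [pow_succ] at h2; linarith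
      have hTt : T ≤ t / 2 := le_trans (le_mul_of_one_le_left hT0.le
        (one_le_pow₀ (by norm_num))) h1'
      have ht0 : 0 < t / 2 := hT0.trans_le hTt
      have h3 := ih _ h1' h2'
      have h4 := (hT _ hTt).1
      rw [lt_div_iff₀ (hpos _), mul_div_cancel₀ t (by norm_num : (2 : ℝ) ≠ 0)] at h4
      have h5 : t ^ s = 2 ^ s * (t / 2) ^ s := by
        rw [← Real.mul_rpow (by norm_num) ht0.le, mul_div_cancel₀ t (by norm_num : (2 : ℝ) ≠ 0)]
      have h6 : r = 2 ^ s * 2 ^ (-u) := by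
        rw [hr, ← Real.rpow_add (by norm_num), sub_eq_add_neg]
      have hp : 0 < (2 : ℝ) ^ s * (t / 2) ^ s :=
        mul_pos (Real.rpow_pos_of_pos (by norm_num) _) (Real.rpow_pos_of_pos ht0 _)
      calc k * r ^ (n + 1) = r * (k * r ^ n) := by ring
        _ ≤ r * ((t / 2) ^ s * f (t / 2)) := by gcongr
        _ = 2 ^ s * (t / 2) ^ s * (2 ^ (-u) * f (t / 2)) := by rw [h6]; ring
        _ ≤ 2 ^ s * (t / 2) ^ s * f t := by gcongr
        _ = t ^ s * f t := by rw [h5]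
  have hinf : Tendsto (fun t => t ^ s * f t) atTop atTop := by
    refine tendsto_atTop.2 fun b => ?_
    obtain ⟨N, hN⟩ := ((tendsto_pow_atTop_atTop_of_one_lt hr1).const_mul_atTop hk0
      |>.eventually_ge_atTop b).exists
    filter_upwards [eventually_ge_atTop (2 ^ N * T)] with t ht
    have htT : 1 ≤ t / T := by
      rw [le_div_iff₀ hT0]
      exact le_trans (mul_le_mul_of_nonneg_right (one_le_pow₀ (by norm_num)) hT0.le) ht
    obtain ⟨n, hn1, hn2⟩ := exists_nat_pow_near htT (by norm_num : (1 : ℝ) < 2)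
    rw [le_div_iff₀ hT0] at hn1
    have hn2' := (div_lt_iff₀ hT0).1 hn2
    have hNn : N ≤ n := by
      have : (2 : ℝ) ^ N < 2 ^ (n + 1) := lt_of_mul_lt_mul_right (ht.trans_lt hn2') hT0.le
      have := (pow_lt_pow_iff_right₀ (by norm_num : (1 : ℝ) < 2)).1 this
      omega
    calc b ≤ k * r ^ N := hN
      _ ≤ k * r ^ n := by gcongr; exact hr1.le
      _ ≤ _ := key n t hn1 hn2'.le
  refine hinf.inv_tendsto_atTop.congr' ?_
  filter_upwards [eventually_gt_atTop 0] with t ht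
  simp only [Pi.inv_apply]
  rw [Real.rpow_neg ht.le, mul_inv, div_eq_mul_inv]

/-- Markov's inequality for a fractional moment. -/
lemma measureReal_lt_abs_le {Ω : Type*} [MeasurableSpace Ω] {μ : Measure Ω} {A : Ω → ℝ}
    (hA : Measurable A) {r u : ℝ} (hr : 0 < r) (hu : 0 < u)
    (hfin : (∫⁻ ω, ENNReal.ofReal (|A ω| ^ r) ∂μ) < ⊤) :
    μ.real {ω | u < |A ω|} ≤ (∫⁻ ω, ENNReal.ofReal (|A ω| ^ r) ∂μ).toReal * u ^ (-r) := by
  have hm : Measurable fun ω => ENNReal.ofReal (|A ω| ^ r) := by fun_prop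
  have hur := Real.rpow_pos_of_pos hu r
  have h := mul_meas_ge_le_lintegral hm (ENNReal.ofReal (u ^ r)) (μ := μ)
  have hsub : μ {ω | u < |A ω|} ≤
      μ {ω | ENNReal.ofReal (u ^ r) ≤ ENNReal.ofReal (|A ω| ^ r)} :=
    measure_mono fun ω hω =>
      ENNReal.ofReal_le_ofReal (Real.rpow_le_rpow hu.le (le_of_lt hω) hr.le)
  have h2 := ENNReal.toReal_mono hfin.ne ((mul_le_mul_right hsub _).trans h)
  rw [ENNReal.toReal_mul, ENNReal.toReal_ofReal hur.le] at h2
  rw [Real.rpow_neg hu.le, ← div_eq_mul_inv, le_div_iff₀ hur, mul_comm]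
  exact h2

section Tails

variable {Ω : Type*} [MeasurableSpace Ω] {μ : Measure Ω} [IsProbabilityMeasure μ]

lemma antitone_measureReal_lt (W : Ω → ℝ) : Antitone fun t => μ.real {ω | t < W ω} :=
  fun _ _ h => measureReal_mono fun _ hω => lt_of_le_of_lt h hω

lemma tendsto_measureReal_lt_atTop {W : Ω → ℝ} (hW : Measurable W) :
    Tendsto (fun t => μ.real {ω | t < W ω}) atTop (𝓝 0) := by
  have h := tendsto_measure_iInter_atTop (μ := μ) (s := fun t : ℝ => {ω | t < W ω})
    (fun t => (measurableSet_lt measurable_const hW).nullMeasurableSet)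
    (fun _ _ h _ hω => lt_of_le_of_lt h hω) ⟨0, measure_ne_top _ _⟩
  have he : ⋂ t : ℝ, {ω | t < W ω} = ∅ := by
    ext ω
    simp only [Set.mem_iInter, Set.mem_ofPred_eq, Set.mem_empty_iff_false, iff_false, not_forall]
    exact ⟨W ω, lt_irrefl _⟩
  rw [he, measure_empty] at h
  exact (ENNReal.tendsto_toReal ENNReal.zero_ne_top).comp h

/-- If `X` is independent of `B` and `A` has a moment of order larger than the index of the tail
of `B`, then `A X` and `B` are unlikely to be large simultaneously, compared with the tail `G`. -/
lemma tendsto_joint_tail_div {A B X : Ω → ℝ} (hA : Measurable A)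
    (hX : Measurable X) (hXB : IndepFun X B μ) {α ν : ℝ} (hα : 0 < α) (hν : 0 < ν)
    (hfin : (∫⁻ ω, ENNReal.ofReal (|A ω| ^ (α + ν)) ∂μ) < ⊤) {G : ℝ → ℝ} (hG : ∀ x, 0 < G x)
    (hpow : ∀ s, α < s → Tendsto (fun x => x ^ (-s) / G x) atTop (𝓝 0))
    {ε m : ℝ}
    (hBG : Tendsto (fun t => μ.real {ω | ε * t < |B ω|} / G t) atTop (𝓝 m))
    {δ : ℝ} (hδ : 0 < δ) :
    Tendsto (fun t => μ.real {ω | δ * t < |A ω * X ω| ∧ ε * t < |B ω|} / G t) atTop (𝓝 0) := by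
  set κ := (α + ν / 2) / (α + ν) with hκ
  have hκ1 : κ < 1 := by rw [hκ, div_lt_one (by linarith)]; linarith
  have hκs : κ * (α + ν) = α + ν / 2 := by rw [hκ]; field_simp
  set M := (∫⁻ ω, ENNReal.ofReal (|A ω| ^ (α + ν)) ∂μ).toReal
  have h1 : Tendsto (fun t : ℝ => δ * t ^ (1 - κ)) atTop atTop :=
    (tendsto_rpow_atTop (by linarith)).const_mul_atTop hδ
  have h2 := ((tendsto_measureReal_lt_atTop (μ := μ) hX.abs).comp h1).mul hBG
  have h3 := (hpow (α + ν / 2) (by linarith)).const_mul M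
  have h4 := h3.add h2
  rw [mul_zero, zero_mul, add_zero] at h4
  refine squeeze_zero' (Eventually.of_forall fun t =>
    div_nonneg measureReal_nonneg (hG t).le) ?_ h4
  filter_upwards [eventually_gt_atTop 0] with t ht
  have htκ := Real.rpow_pos_of_pos ht κ
  have hsub : {ω | δ * t < |A ω * X ω| ∧ ε * t < |B ω|} ⊆ {ω | t ^ κ < |A ω|} ∪
      ({ω | δ * t ^ (1 - κ) < |X ω|} ∩ {ω | ε * t < |B ω|}) := by
    rintro ω ⟨hω1, hω2⟩
    by_cases hAω : t ^ κ < |A ω|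
    · exact Or.inl hAω
    · refine Or.inr ⟨?_, hω2⟩
      rw [not_lt] at hAω
      have h5 : t = t ^ κ * t ^ (1 - κ) := by
        rw [← Real.rpow_add ht, add_sub_cancel, Real.rpow_one]
      have h6 : δ * t < t ^ κ * |X ω| := by
        rw [abs_mul] at hω1
        exact hω1.trans_le (mul_le_mul_of_nonneg_right hAω (abs_nonneg _))
      have h7 : t ^ κ * (δ * t ^ (1 - κ)) = δ * t := by
        conv_rhs => rw [h5]
        ring
      rw [← h7] at h6
      exact lt_of_mul_lt_mul_left h6 htκ.le
  have hind : μ.real ({ω | δ * t ^ (1 - κ) < |X ω|} ∩ {ω | ε * t < |B ω|}) =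
      μ.real {ω | δ * t ^ (1 - κ) < |X ω|} * μ.real {ω | ε * t < |B ω|} := by
    have := hXB.measure_inter_preimage_eq_mul {x | δ * t ^ (1 - κ) < |x|} {x | ε * t < |x|}
      (measurableSet_lt measurable_const measurable_abs)
      (measurableSet_lt measurable_const measurable_abs)
    simp only [Measure.real, ← ENNReal.toReal_mul]
    exact congrArg _ this
  have hmk := measureReal_lt_abs_le hA (by linarith : 0 < α + ν) htκ hfin
  rw [← Real.rpow_mul ht.le, mul_neg, hκs] at hmk
  have hle : μ.real {ω | δ * t < |A ω * X ω| ∧ ε * t < |B ω|} ≤ M * t ^ (-(α + ν / 2)) +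
      μ.real {ω | δ * t ^ (1 - κ) < |X ω|} * μ.real {ω | ε * t < |B ω|} := by
    rw [← hind]
    exact (measureReal_mono hsub).trans ((measureReal_union_le _ _).trans (by gcongr))
  refine (div_le_div_of_nonneg_right hle (hG t).le).trans_eq ?_
  simp only [Function.comp_apply]
  ring

lemma tail_add_le {Q B : Ω → ℝ} (ε t : ℝ) :
    μ.real {ω | t < Q ω + B ω} ≤ μ.real {ω | (1 - ε) * t < Q ω} + μ.real {ω | (1 - ε) * t < B ω} +
      μ.real {ω | ε * t < |Q ω| ∧ ε * t < |B ω|} := by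
  have hsub : {ω | t < Q ω + B ω} ⊆ ({ω | (1 - ε) * t < Q ω} ∪ {ω | (1 - ε) * t < B ω}) ∪
      {ω | ε * t < |Q ω| ∧ ε * t < |B ω|} := by
    intro ω hω
    simp only [Set.mem_union, Set.mem_ofPred_eq] at hω ⊢
    by_contra! hcon
    obtain ⟨⟨h1, h2⟩, h3⟩ := hcon
    have hQ : ε * t < |Q ω| := lt_of_lt_of_le (by linarith) (le_abs_self _)
    have hB : ε * t < |B ω| := lt_of_lt_of_le (by linarith) (le_abs_self _)
    exact absurd (h3 hQ) (not_le.2 hB)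
  refine (measureReal_mono hsub).trans ((measureReal_union_le _ _).trans ?_)
  gcongr
  exact measureReal_union_le _ _

lemma le_tail_add {Q B : Ω → ℝ} (hB : Measurable B) {ε t : ℝ}
    (hε : 0 < ε) (ht : 0 < t) :
    μ.real {ω | (1 + ε) * t < Q ω} + μ.real {ω | (1 + ε) * t < B ω} ≤
      μ.real {ω | t < Q ω + B ω} + 2 * μ.real {ω | ε * t < |Q ω| ∧ ε * t < |B ω|} := by
  have hεt := mul_pos hε ht
  have hunion : {ω | (1 + ε) * t < Q ω} ∪ {ω | (1 + ε) * t < B ω} ⊆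
      {ω | t < Q ω + B ω} ∪ {ω | ε * t < |Q ω| ∧ ε * t < |B ω|} := by
    intro ω hω
    by_cases hQB : t < Q ω + B ω
    · exact Or.inl hQB
    · right
      rw [not_lt] at hQB
      rcases hω with hω | hω <;> simp only [Set.mem_ofPred_eq] at hω
      · exact ⟨lt_of_lt_of_le (by linarith) (le_abs_self _),
          lt_of_lt_of_le (by linarith) (neg_le_abs _)⟩
      · exact ⟨lt_of_lt_of_le (by linarith) (neg_le_abs _),
          lt_of_lt_of_le (by linarith) (le_abs_self _)⟩
  have hinter : {ω | (1 + ε) * t < Q ω} ∩ {ω | (1 + ε) * t < B ω} ⊆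
      {ω | ε * t < |Q ω| ∧ ε * t < |B ω|} := by
    rintro ω ⟨hω1, hω2⟩
    simp only [Set.mem_ofPred_eq] at hω1 hω2
    exact ⟨lt_of_lt_of_le (by linarith) (le_abs_self _),
      lt_of_lt_of_le (by linarith) (le_abs_self _)⟩
  rw [← measureReal_union_add_inter (measurableSet_lt measurable_const hB)]
  have h1 := (measureReal_mono (μ := μ) hunion).trans (measureReal_union_le _ _)
  have h2 := measureReal_mono (μ := μ) hinter
  linarith

end Tails

/-- A function whose ratios under rescaling by `c` tend to `c ^ (-θ)` changes by an arbitrarily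
small factor under rescalings close to the identity. -/
lemma eventually_rescale_bounds {f : ℝ → ℝ} {θ : ℝ} (hpos : ∀ᶠ x in atTop, 0 < f x)
    (hf : ∀ c > 0, Tendsto (fun x => f (c * x) / f x) atTop (𝓝 (c ^ (-θ))))
    {η : ℝ} (hη : 0 < η) :
    ∀ᶠ ε in 𝓝[>] (0 : ℝ), ∀ᶠ t in atTop,
      f ((1 - ε) * t) ≤ (1 + η) * f t ∧ (1 - η) * f t ≤ f ((1 + ε) * t) := by
  have h1 : Tendsto (fun ε : ℝ => (1 - ε) ^ (-θ)) (𝓝 0) (𝓝 1) := by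
    have : ContinuousAt (fun ε : ℝ => (1 - ε) ^ (-θ)) 0 :=
      ContinuousAt.rpow_const (by fun_prop) (Or.inl (by norm_num))
    simpa [ContinuousAt] using this
  have h2 : Tendsto (fun ε : ℝ => (1 + ε) ^ (-θ)) (𝓝 0) (𝓝 1) := by
    have : ContinuousAt (fun ε : ℝ => (1 + ε) ^ (-θ)) 0 :=
      ContinuousAt.rpow_const (by fun_prop) (Or.inl (by norm_num))
    simpa [ContinuousAt] using this
  filter_upwards [nhdsWithin_le_nhds (h1.eventually (gt_mem_nhds (by linarith : 1 < 1 + η))),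
    nhdsWithin_le_nhds (h2.eventually (lt_mem_nhds (by linarith : 1 - η < 1))),
    Ioo_mem_nhdsGT (zero_lt_one' ℝ)] with ε hε1 hε2 hε
  filter_upwards [hpos, (hf (1 - ε) (by linarith [hε.2])).eventually (gt_mem_nhds hε1),
    (hf (1 + ε) (by linarith [hε.1])).eventually (lt_mem_nhds hε2)] with t ht ht1 ht2
  exact ⟨((div_lt_iff₀ ht).1 ht1).le, ((lt_div_iff₀ ht).1 ht2).le⟩

/-- If `A₁, A₂, A₃` are positive random variables such that each pair
`(Aᵢ, B)` satisfies the Grey assumption with index `α > 0`, and `(X,Y,Z) ⟂ (A₁,A₂,A₃,B)`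
with `Q := A₁X + A₂Y + A₃Z` either regularly varying or with tail negligible relative to
that of `B`, then `ℙ(A₁X + A₂Y + A₃Z + B > t) ~ ℙ(A₁X + A₂Y + A₃Z > t) + ℙ(B > t)`. -/
theorem stmt9
    {Ω : Type*} [MeasurableSpace Ω] (μ : Measure Ω) [IsProbabilityMeasure μ]
    (A₁ A₂ A₃ B X Y Z : Ω → ℝ)
    (hA₁ : Measurable A₁) (hA₂ : Measurable A₂) (hA₃ : Measurable A₃)
    (hB : Measurable B) (hX : Measurable X) (hY : Measurable Y) (hZ : Measurable Z)
    (hA₁pos : ∀ᵐ ω ∂μ, 0 < A₁ ω) (hA₂pos : ∀ᵐ ω ∂μ, 0 < A₂ ω)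
    (hA₃pos : ∀ᵐ ω ∂μ, 0 < A₃ ω)
    (α : ℝ) (hα : 0 < α)
    (hGrey₁ : GreyAssumption μ A₁ B α) (hGrey₂ : GreyAssumption μ A₂ B α)
    (hGrey₃ : GreyAssumption μ A₃ B α)
    (hindep : IndepFun (fun ω => (X ω, Y ω, Z ω))
        (fun ω => (A₁ ω, A₂ ω, A₃ ω, B ω)) μ)
    (hQtail : (∃ θ > 0, RegularlyVaryingTail μ
          (fun ω => A₁ ω * X ω + A₂ ω * Y ω + A₃ ω * Z ω) θ) ∨
      (fun t => (μ {ω | t < A₁ ω * X ω + A₂ ω * Y ω + A₃ ω * Z ω}).toReal) =o[atTop]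
        fun t => (μ {ω | t < B ω}).toReal) :
    Tendsto (fun t =>
        (μ {ω | t < A₁ ω * X ω + A₂ ω * Y ω + A₃ ω * Z ω + B ω}).toReal /
          ((μ {ω | t < A₁ ω * X ω + A₂ ω * Y ω + A₃ ω * Z ω}).toReal +
            (μ {ω | t < B ω}).toReal))
      atTop (𝓝 1) := by
  obtain ⟨⟨ν₁, hν₁, -, hfin₁⟩, p, q, l, hp, hq, -, hl, hBp, hBq⟩ := hGrey₁
  obtain ⟨⟨ν₂, hν₂, -, hfin₂⟩, -⟩ := hGrey₂
  obtain ⟨⟨ν₃, hν₃, -, hfin₃⟩, -⟩ := hGrey₃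
  set Q : Ω → ℝ := fun ω => A₁ ω * X ω + A₂ ω * Y ω + A₃ ω * Z ω with hQ
  set G : ℝ → ℝ := fun t => μ.real {ω | t < B ω} with hGdef
  set F : ℝ → ℝ := fun t => μ.real {ω | t < Q ω} with hFdef
  have hGanti : Antitone G := antitone_measureReal_lt B
  have hGev : ∀ᶠ x in atTop, 0 < G x := by
    filter_upwards [hBp.eventually (lt_mem_nhds hp), eventually_gt_atTop 0] with x hx hx0
    have hden : 0 < x ^ (-α) * l x := mul_pos (Real.rpow_pos_of_pos hx0 _) (hl.2.1 x hx0)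
    exact (div_pos_iff_of_pos_right hden).1 hx
  have hG : ∀ x, 0 < G x := fun x => by
    obtain ⟨y, hy, hxy⟩ := (hGev.and (eventually_ge_atTop x)).exists
    exact hy.trans_le (hGanti hxy)
  have hGratio : ∀ c > 0, Tendsto (fun x => G (c * x) / G x) atTop (𝓝 (c ^ (-α))) := by
    intro c hc
    have h := hl.tendsto_comp_mul_div hp.ne' hBp hBp hc
    rwa [div_self hp.ne', one_mul] at h
  have hpow : ∀ s, α < s → Tendsto (fun x => x ^ (-s) / G x) atTop (𝓝 0) := fun s hs =>
    hGanti.rpow_neg_div_tendsto_zero hG (hα.trans hs) hs (hGratio 2 two_pos)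
  have habs : ∀ ε > 0, ∃ m, Tendsto (fun t => μ.real {ω | ε * t < |B ω|} / G t) atTop (𝓝 m) := by
    intro ε hε
    refine ⟨_, ((hGratio ε hε).add (hl.tendsto_comp_mul_div hp.ne' hBp hBq hε)).congr' ?_⟩
    filter_upwards [eventually_gt_atTop 0] with t ht
    have hunion : {ω | ε * t < |B ω|} = {ω | ε * t < B ω} ∪ {ω | ε * t < -B ω} := by
      ext ω
      simp [lt_abs]
    have hdisj : Disjoint {ω | ε * t < B ω} {ω | ε * t < -B ω} := by
      rw [Set.disjoint_left]
      intro ω h1 h2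
      simp only [Set.mem_ofPred_eq] at h1 h2
      linarith [mul_pos hε ht]
    rw [hunion, measureReal_union hdisj (measurableSet_lt measurable_const hB.neg), add_div]
    rfl
  have hindX : IndepFun X B μ := hindep.comp (φ := fun v : ℝ × ℝ × ℝ => v.1)
    (ψ := fun v : ℝ × ℝ × ℝ × ℝ => v.2.2.2) (by fun_prop) (by fun_prop)
  have hindY : IndepFun Y B μ := hindep.comp (φ := fun v : ℝ × ℝ × ℝ => v.2.1)
    (ψ := fun v : ℝ × ℝ × ℝ × ℝ => v.2.2.2) (by fun_prop) (by fun_prop)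
  have hindZ : IndepFun Z B μ := hindep.comp (φ := fun v : ℝ × ℝ × ℝ => v.2.2)
    (ψ := fun v : ℝ × ℝ × ℝ × ℝ => v.2.2.2) (by fun_prop) (by fun_prop)
  have hjoint : ∀ ε > 0, Tendsto
      (fun t => μ.real {ω | ε * t < |Q ω| ∧ ε * t < |B ω|} / G t) atTop (𝓝 0) := by
    intro ε hε
    obtain ⟨m, hm⟩ := habs ε hε
    have hε3 : 0 < ε / 3 := by positivity
    have h := ((tendsto_joint_tail_div hA₁ hX hindX hα hν₁ hfin₁ hG hpow hm hε3).add
      (tendsto_joint_tail_div hA₂ hY hindY hα hν₂ hfin₂ hG hpow hm hε3)).add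
      (tendsto_joint_tail_div hA₃ hZ hindZ hα hν₃ hfin₃ hG hpow hm hε3)
    rw [add_zero, add_zero] at h
    refine squeeze_zero (fun t => div_nonneg measureReal_nonneg (hG t).le) (fun t => ?_) h
    rw [← add_div, ← add_div]
    refine div_le_div_of_nonneg_right ?_ (hG t).le
    have hsub : {ω | ε * t < |Q ω| ∧ ε * t < |B ω|} ⊆
        ({ω | ε / 3 * t < |A₁ ω * X ω| ∧ ε * t < |B ω|} ∪
          {ω | ε / 3 * t < |A₂ ω * Y ω| ∧ ε * t < |B ω|}) ∪
          {ω | ε / 3 * t < |A₃ ω * Z ω| ∧ ε * t < |B ω|} := by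
      rintro ω ⟨h1, h2⟩
      simp only [Set.mem_union, Set.mem_ofPred_eq, h2, and_true]
      by_contra! hcon
      have htri := abs_add_three (A₁ ω * X ω) (A₂ ω * Y ω) (A₃ ω * Z ω)
      simp only [hQ] at h1
      linarith [hcon.1.1, hcon.1.2, hcon.2]
    refine (measureReal_mono hsub).trans ((measureReal_union_le _ _).trans ?_)
    gcongr
    exact measureReal_union_le _ _
  have hF0 : ∀ t, 0 ≤ F t := fun t => measureReal_nonneg
  have hFbounds : ∀ η > 0, ∀ᶠ ε in 𝓝[>] (0 : ℝ), ∀ᶠ t in atTop,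
      F ((1 - ε) * t) ≤ (1 + η) * F t + η * G t ∧
        (1 - η) * F t - η * G t ≤ F ((1 + ε) * t) := by
    intro η hη
    rcases hQtail with ⟨θ, -, L, hL, hFL⟩ | ho
    · have hFlim : Tendsto (fun x => F x / (x ^ (-θ) * L x)) atTop (𝓝 1) := by
        refine tendsto_const_nhds.congr' ?_
        filter_upwards [hFL, eventually_gt_atTop 0] with x hx hx0
        have hden : 0 < x ^ (-θ) * L x := mul_pos (Real.rpow_pos_of_pos hx0 _) (hL.2.1 x hx0)
        rw [show F x = x ^ (-θ) * L x from hx, div_self hden.ne']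
      have hFpos : ∀ᶠ x in atTop, 0 < F x := by
        filter_upwards [hFL, eventually_gt_atTop 0] with x hx hx0
        rw [show F x = x ^ (-θ) * L x from hx]
        exact mul_pos (Real.rpow_pos_of_pos hx0 _) (hL.2.1 x hx0)
      have hFratio : ∀ c > 0, Tendsto (fun x => F (c * x) / F x) atTop (𝓝 (c ^ (-θ))) := by
        intro c hc
        simpa using hL.tendsto_comp_mul_div one_ne_zero hFlim hFlim hc
      filter_upwards [eventually_rescale_bounds hFpos hFratio hη] with ε hε
      filter_upwards [hε] with t ht
      have := mul_pos hη (hG t)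
      exact ⟨by linarith [ht.1], by linarith [ht.2]⟩
    · have hFG : ∀ k > 0, ∀ᶠ t in atTop, F t ≤ k * G t := by
        intro k hk
        filter_upwards [ho.bound hk] with t ht
        rw [Real.norm_of_nonneg ENNReal.toReal_nonneg,
          Real.norm_of_nonneg ENNReal.toReal_nonneg] at ht
        exact ht
      filter_upwards [eventually_rescale_bounds hGev hGratio one_pos,
        Ioo_mem_nhdsGT (zero_lt_one' ℝ)] with ε hε hε1
      have hscale : Tendsto (fun t : ℝ => (1 - ε) * t) atTop atTop :=
        tendsto_id.const_mul_atTop (by linarith [hε1.2])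
      filter_upwards [hε, hscale.eventually (hFG (η / 2) (by positivity)), hFG η hη]
        with t ht h1 h2
      have h3 := mul_le_mul_of_nonneg_left ht.1 (by positivity : 0 ≤ η / 2)
      have h4 := mul_nonneg hη.le (hF0 t)
      exact ⟨by linarith [hF0 t], by linarith [hF0 ((1 + ε) * t)]⟩
  have hmain : ∀ η > 0, ∀ᶠ t in atTop,
      |μ.real {ω | t < Q ω + B ω} / (F t + G t) - 1| ≤ 5 * η := by
    intro η hη
    obtain ⟨ε, ⟨hεF, hεG⟩, hε⟩ := (((hFbounds η hη).and
      (eventually_rescale_bounds hGev hGratio hη)).and self_mem_nhdsWithin).exists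
    filter_upwards [hεF, hεG, (hjoint ε hε).eventually (gt_mem_nhds hη),
      eventually_gt_atTop 0] with t h1 h2 h3 ht
    have hD : 0 < F t + G t := add_pos_of_nonneg_of_pos (hF0 t) (hG t)
    have h3' := (div_lt_iff₀ (hG t)).1 h3
    have hup := tail_add_le (μ := μ) (Q := Q) (B := B) ε t
    have hlow := le_tail_add (μ := μ) (Q := Q) hB hε ht
    have h4 := mul_nonneg hη.le (hF0 t)
    have h5 := mul_nonneg hη.le (hG t).le
    simp only [hFdef, hGdef] at h1 h2 h3' h4 h5 hD ⊢
    rw [div_sub_one hD.ne', abs_div, abs_of_pos hD, div_le_iff₀ hD, abs_le]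
    constructor <;> linarith [h1.1, h1.2, h2.1, h2.2]
  rw [Metric.tendsto_nhds]
  intro e he
  filter_upwards [hmain (e / 10) (by positivity)] with t ht
  rw [Real.dist_eq]
  exact lt_of_le_of_lt ht (by linarith)
end

section
/- Let A, B, X be real random variables on a common probability space such that A ≥ 0 almost surely, X is independent of the pair (A, B), and ℙ(|B| > t) > 0 for every t ∈ ℝ. Assume that for every c > 0, lim_{t→∞} ℙ(cA > t | |B| > t) = 0. Then lim_{t→∞} ℙ(A·|X| > t | |B| > t) = 0. -/
open MeasureTheory Filter ProbabilityTheory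
open scoped Topology

/-- The tails of a real random variable are eventually smaller than any positive number. -/
theorem exists_pos_measure_abs_gt_toReal_lt {Ω : Type*} [MeasurableSpace Ω] (μ : Measure Ω)
    [IsFiniteMeasure μ] {X : Ω → ℝ} (hX : Measurable X) {ε : ℝ} (hε : 0 < ε) :
    ∃ K : ℝ, 0 < K ∧ (μ {ω | K < |X ω|}).toReal < ε := by
  have hanti : Antitone fun K : ℝ => {ω | K < |X ω|} :=
    fun _ _ hab _ hω => lt_of_le_of_lt hab hω
  have hmeas (K : ℝ) : MeasurableSet {ω | K < |X ω|} :=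
    measurableSet_lt measurable_const hX.abs
  have hempty : ⋂ K : ℝ, {ω | K < |X ω|} = ∅ :=
    Set.eq_empty_of_forall_notMem fun ω hω => lt_irrefl |X ω| (Set.mem_iInter.mp hω |X ω|)
  have hlim : Tendsto (fun K : ℝ => μ {ω | K < |X ω|}) atTop (𝓝 0) := by
    have h := tendsto_measure_iInter_atTop (μ := μ) (fun K => (hmeas K).nullMeasurableSet) hanti
      ⟨0, measure_ne_top _ _⟩
    rwa [hempty, measure_empty] at h
  have hreal := (ENNReal.tendsto_toReal ENNReal.zero_ne_top).comp hlim
  obtain ⟨K, hK, hKpos⟩ := ((hreal.eventually_lt_const hε).and (eventually_gt_atTop 0)).exists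
  exact ⟨K, hKpos, hK⟩

/-- If `A ≥ 0` a.s., `X ⟂ (A,B)`, `ℙ(|B| > t) > 0` for every `t`, and
`ℙ(cA > t ∣ |B| > t) → 0` for every `c > 0`, then `ℙ(A|X| > t ∣ |B| > t) → 0`. -/
theorem stmt11
    {Ω : Type*} [MeasurableSpace Ω] (μ : Measure Ω) [IsProbabilityMeasure μ]
    (A B X : Ω → ℝ) (hA : Measurable A) (hB : Measurable B) (hX : Measurable X)
    (hAnn : ∀ᵐ ω ∂μ, 0 ≤ A ω)
    (hindep : IndepFun X (fun ω => (A ω, B ω)) μ)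
    (hBpos : ∀ t : ℝ, 0 < μ {ω | t < |B ω|})
    (hsmall : ∀ c > 0, Tendsto (fun t =>
        (μ ({ω | t < c * A ω} ∩ {ω | t < |B ω|})).toReal /
          (μ {ω | t < |B ω|}).toReal) atTop (𝓝 0)) :
    Tendsto (fun t =>
        (μ ({ω | t < A ω * |X ω|} ∩ {ω | t < |B ω|})).toReal /
          (μ {ω | t < |B ω|}).toReal) atTop (𝓝 0) := by
  have hBreal (t : ℝ) : 0 < (μ {ω | t < |B ω|}).toReal :=
    ENNReal.toReal_pos (hBpos t).ne' (measure_ne_top _ _)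
  refine tendsto_order.2 ⟨fun a ha => Eventually.of_forall fun t =>
    ha.trans_le (by positivity), fun ε hε => ?_⟩
  obtain ⟨K, hK, hXK⟩ := exists_pos_measure_abs_gt_toReal_lt μ hX (half_pos hε)
  filter_upwards [(hsmall K hK).eventually_lt_const (half_pos hε)] with t ht
  have hprod : μ ({ω | K < |X ω|} ∩ {ω | t < |B ω|}) =
      μ {ω | K < |X ω|} * μ {ω | t < |B ω|} :=
    hindep.measure_inter_preimage_eq_mul {x : ℝ | K < |x|} {p : ℝ × ℝ | t < |p.2|}
      (measurableSet_lt measurable_const measurable_id.abs)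
      (measurableSet_lt measurable_const measurable_snd.abs)
  have hsub : μ ({ω | t < A ω * |X ω|} ∩ {ω | t < |B ω|}) ≤
      μ (({ω | t < K * A ω} ∩ {ω | t < |B ω|}) ∪ ({ω | K < |X ω|} ∩ {ω | t < |B ω|})) := by
    refine measure_mono_ae ?_
    filter_upwards [hAnn] with ω hω
    rintro ⟨hAX, hBt⟩
    rcases lt_or_ge K |X ω| with hKX | hKX
    · exact Or.inr ⟨hKX, hBt⟩
    · refine Or.inl ⟨?_, hBt⟩
      calc t < A ω * |X ω| := hAX
        _ ≤ A ω * K := mul_le_mul_of_nonneg_left hKX hω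
        _ = K * A ω := mul_comm _ _
  have hle : (μ ({ω | t < A ω * |X ω|} ∩ {ω | t < |B ω|})).toReal ≤
      (μ ({ω | t < K * A ω} ∩ {ω | t < |B ω|})).toReal +
        (μ {ω | K < |X ω|}).toReal * (μ {ω | t < |B ω|}).toReal := by
    rw [← ENNReal.toReal_mul, ← hprod,
      ← ENNReal.toReal_add (measure_ne_top _ _) (measure_ne_top _ _)]
    exact ENNReal.toReal_mono (by finiteness) (hsub.trans (measure_union_le _ _))
  rw [div_lt_iff₀ (hBreal t)] at ht ⊢
  linarith [mul_lt_mul_of_pos_right hXK (hBreal t)]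
end

section
/- Let d ≥ 1, α ∈ (0,1), and let ψ : ℝ^d → {0,1} be a Borel-measurable test. Let 𝒫 be a set of Borel probability measures on ℝ^d such that P({ψ = 1}) ≤ α for every P ∈ 𝒫, and let Q be a Borel probability measure on ℝ^d that is absolutely continuous with respect to Lebesgue measure μ. Suppose the following approximation property holds: for every δ > 0 there exists L > 0 such that for every ε > 0 and every Borel set B ⊆ ℝ^d there exist random vectors W and W̃ defined on a common probability space with law(W) = Q, law(W̃) ∈ 𝒫, ℙ(‖W − W̃‖_∞ < ε) > 1 − δ, and ℙ(W̃ ∈ B) ≤ L·μ(B). Then Q({ψ = 1}) ≤ α. -/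
open MeasureTheory Filter
open scoped Topology ENNReal

/-- Closed thickenings of a compact set exceed it by arbitrarily little mass. -/
theorem IsCompact.exists_measure_cthickening_diff_le {X : Type*} [MetricSpace X]
    [ProperSpace X] [MeasurableSpace X] [BorelSpace X] (μ : Measure X)
    [IsFiniteMeasureOnCompacts μ] {K : Set X} (hK : IsCompact K) {c : ℝ≥0∞} (hc : c ≠ 0) :
    ∃ ε > (0 : ℝ), μ (Metric.cthickening ε K \ K) ≤ c := by
  have hlt : μ K < μ K + c := ENNReal.lt_add_right hK.measure_lt_top.ne hc
  have hev : ∀ᶠ r in 𝓝[>] (0 : ℝ), μ (Metric.cthickening r K) < μ K + c :=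
    ((tendsto_measure_cthickening_of_isCompact hK).mono_left nhdsWithin_le_nhds).eventually_lt_const
      hlt
  obtain ⟨ε, hε, hpos⟩ := (hev.and self_mem_nhdsWithin).exists
  refine ⟨ε, hpos, ?_⟩
  rw [measure_sdiff (Metric.self_subset_cthickening K) hK.measurableSet.nullMeasurableSet
    hK.measure_lt_top.ne]
  exact tsub_le_iff_left.2 hε.le

/-- If `W` lies in `K` then `W'` lies in `A`, or in a thickening of `K` outside `A`, or is far
from `W`. -/
theorem measure_preimage_le_add_cthickening_diff {Ω E : Type*} [MeasurableSpace Ω]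
    [SeminormedAddCommGroup E] (P : Measure Ω) (W W' : Ω → E) (K A : Set E) (ε : ℝ) :
    P (W ⁻¹' K) ≤ P (W' ⁻¹' A) + P (W' ⁻¹' (Metric.cthickening ε K \ A)) +
      P {ω | ‖W ω - W' ω‖ < ε}ᶜ := by
  refine (measure_mono ?_).trans
    ((measure_union_le _ _).trans (add_le_add_left (measure_union_le _ _) _))
  intro ω hω
  by_cases hfar : ‖W ω - W' ω‖ < ε
  · by_cases hA : W' ω ∈ A
    · exact Or.inl (Or.inl hA)
    · refine Or.inl (Or.inr ⟨Metric.mem_cthickening_of_dist_le _ _ _ _ hω ?_, hA⟩)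
      rw [dist_comm, dist_eq_norm]
      exact hfar.le
  · exact Or.inr hfar

/-- No-free-lunch core. Let `ψ` be a Borel test on `ℝ^d` with rejection
probability at most `α` under every `P ∈ PP`, and let `Q ≪ Lebesgue` be a probability
measure such that for every `δ > 0` there is `L > 0` with the coupling approximation
property: for every `ε > 0` and Borel `B` there are random vectors `W ∼ Q` and
`W̃ ∼ P ∈ PP` on a common probability space with `ℙ(‖W − W̃‖_∞ < ε) > 1 − δ` and
`ℙ(W̃ ∈ B) ≤ L·μ(B)`. Then `Q(ψ = 1) ≤ α`. -/
theorem stmt13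
    (d : ℕ) (hd : 1 ≤ d) (α : ℝ) (hα : α ∈ Set.Ioo (0 : ℝ) 1)
    (ψ : (Fin d → ℝ) → Bool) (hψ : Measurable ψ)
    (PP : Set (Measure (Fin d → ℝ)))
    (hPPprob : ∀ P ∈ PP, IsProbabilityMeasure P)
    (hPPlevel : ∀ P ∈ PP, P {x | ψ x = true} ≤ ENNReal.ofReal α)
    (Q : Measure (Fin d → ℝ)) [IsProbabilityMeasure Q]
    (hQac : Q ≪ volume)
    (happrox : ∀ δ > (0 : ℝ), ∃ L > (0 : ℝ), ∀ ε > (0 : ℝ),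
      ∀ B : Set (Fin d → ℝ), MeasurableSet B →
      ∃ (Ω' : Type) (_ : MeasurableSpace Ω') (P' : Measure Ω')
        (_ : IsProbabilityMeasure P') (W W' : Ω' → (Fin d → ℝ)),
          Measurable W ∧ Measurable W' ∧
          Measure.map W P' = Q ∧ Measure.map W' P' ∈ PP ∧
          ENNReal.ofReal (1 - δ) < P' {ω | ‖W ω - W' ω‖ < ε} ∧
          P' (W' ⁻¹' B) ≤ ENNReal.ofReal L * volume B) :
    Q {x | ψ x = true} ≤ ENNReal.ofReal α := by
  have hA : MeasurableSet {x | ψ x = true} := hψ (measurableSet_singleton true)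
  refine ENNReal.le_of_forall_pos_le_add fun η hη _ => ?_
  set δ : ℝ := η / 3 with hδ_def
  have hδ : 0 < δ := by positivity
  have hδ0 : ENNReal.ofReal δ ≠ 0 := (ENNReal.ofReal_pos.2 hδ).ne'
  obtain ⟨L, hL, happroxL⟩ := happrox δ hδ
  have hL0 : ENNReal.ofReal L ≠ 0 := (ENNReal.ofReal_pos.2 hL).ne'
  obtain ⟨K, hKA, hK, hQK⟩ := hA.exists_isCompact_lt_add (measure_ne_top Q _) hδ0
  obtain ⟨ε, hε, hvol⟩ := hK.exists_measure_cthickening_diff_le volume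
    (ENNReal.div_pos hδ0 (ENNReal.ofReal_ne_top (r := L))).ne'
  obtain ⟨Ω, _, P, _, W, W', hW, hW', hWQ, hWP, hclose, hB⟩ := happroxL ε hε
    (Metric.cthickening ε K \ {x | ψ x = true}) (Metric.isClosed_cthickening.measurableSet.diff hA)
  have hlevel : P (W' ⁻¹' {x | ψ x = true}) ≤ ENNReal.ofReal α := by
    rw [← Measure.map_apply hW' hA]
    exact hPPlevel _ hWP
  have hbad : P (W' ⁻¹' (Metric.cthickening ε K \ {x | ψ x = true})) ≤ ENNReal.ofReal δ :=
    calc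
      _ ≤ ENNReal.ofReal L * volume (Metric.cthickening ε K \ {x | ψ x = true}) := hB
      _ ≤ ENNReal.ofReal L * (ENNReal.ofReal δ / ENNReal.ofReal L) := by
        gcongr
        exact (measure_mono (Set.sdiff_subset_sdiff_right hKA)).trans hvol
      _ = ENNReal.ofReal δ := ENNReal.mul_div_cancel hL0 ENNReal.ofReal_ne_top
  have hfar : P {ω | ‖W ω - W' ω‖ < ε}ᶜ ≤ ENNReal.ofReal δ := by
    have hnear : MeasurableSet {ω | ‖W ω - W' ω‖ < ε} :=
      measurableSet_lt (hW.sub hW').norm measurable_const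
    rw [prob_compl_eq_one_sub hnear, tsub_le_iff_left]
    calc
      (1 : ℝ≥0∞) = ENNReal.ofReal (1 - δ + δ) := by simp
      _ ≤ ENNReal.ofReal (1 - δ) + ENNReal.ofReal δ := ENNReal.ofReal_add_le
      _ ≤ _ := by gcongr
  have hsum : ENNReal.ofReal δ + ENNReal.ofReal δ + ENNReal.ofReal δ = η := by
    rw [← ENNReal.ofReal_add hδ.le hδ.le, ← ENNReal.ofReal_add (by positivity) hδ.le,
      ← ENNReal.ofReal_coe_nnreal]
    congr 1
    rw [hδ_def]
    ring
  calc
    Q {x | ψ x = true} ≤ Q K + ENNReal.ofReal δ := hQK.le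
    _ = P (W ⁻¹' K) + ENNReal.ofReal δ := by rw [← hWQ, Measure.map_apply hW hK.measurableSet]
    _ ≤ ENNReal.ofReal α + ENNReal.ofReal δ + ENNReal.ofReal δ + ENNReal.ofReal δ := by
      gcongr
      exact (measure_preimage_le_add_cthickening_diff P W W' K {x | ψ x = true} ε).trans
        (add_le_add (add_le_add hlevel hbad) hfar)
    _ = ENNReal.ofReal α + η := by rw [← hsum]; ring
end

section
/- Let (Ω, ℙ) be a probability space carrying random variables W : Ω → ℝ^k, X : Ω → ℝ and E : Ω → ℝ, let h : ℝ × ℝ^k × ℝ → ℝ be measurable, and set Y′ := h(X, W, E). Let ν be the law of W and let κ be a regular conditional distribution of (X, E) given W such that for ν-almost every w: (a) κ_w is a product measure μ_w ⊗ ρ_w on ℝ × ℝ, and (b) μ_w((v,∞)) > 0 for every v ∈ ℝ. Let F : ℝ → [0,1) be a nondecreasing function with lim_{x→∞} F(x) = 1. For w ∈ ℝ^k define Γ(w) := lim_{v→∞} ( ∫ F(h(x,w,e)) 1{x > v} dκ_w(x,e) ) / μ_w((v,∞)) whenever the limit exists, and Γ^baseline(w) := ∫ F(h(x,w,e)) dκ_w(x,e).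 Then: (i) if lim_{x→∞} h(x, w, e) = +∞ for every (w, e) ∈ ℝ^k × ℝ, then for ν-almost every w the limit Γ(w) exists and equals 1; (ii) if h does not depend on its first argument (h(x,w,e) = h(x′,w,e) for all x, x′, w, e), then for ν-almost every w the limit Γ(w) exists and equals Γ^baseline(w), and Γ^baseline(w) < 1. -/
open MeasureTheory ProbabilityTheory Filter
open scoped Topology

/-- Conditional averages over the tails `(v, ∞)` of a bounded function converging at `+∞`
converge to the same limit. -/
theorem tendsto_tail_average (m : Measure ℝ) [IsProbabilityMeasure m]
    (hm : ∀ v : ℝ, 0 < m (Set.Ioi v)) (f : ℝ → ℝ) (hf : Integrable f m)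
    (hf_le : ∀ x, f x ≤ 1) (hf_lim : Tendsto f atTop (𝓝 1)) :
    Tendsto (fun v => (∫ x in Set.Ioi v, f x ∂m) / m.real (Set.Ioi v)) atTop (𝓝 1) := by
  have hpos : ∀ v, 0 < m.real (Set.Ioi v) := fun v =>
    ENNReal.toReal_pos (hm v).ne' (measure_ne_top _ _)
  have hconst : ∀ (v c : ℝ), ∫ _ in Set.Ioi v, c ∂m = c * m.real (Set.Ioi v) := fun v c => by
    rw [setIntegral_const, smul_eq_mul, mul_comm]
  refine tendsto_order.2 ⟨fun a ha => ?_, fun a ha => ?_⟩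
  · obtain ⟨b, hab, hb⟩ := exists_between ha
    obtain ⟨N, hN⟩ := eventually_atTop.1 (hf_lim.eventually (lt_mem_nhds hb))
    filter_upwards [eventually_ge_atTop N] with v hv
    refine hab.trans_le ((le_div_iff₀ (hpos v)).2 ?_)
    rw [← hconst]
    exact setIntegral_mono_on (integrable_const b).integrableOn hf.integrableOn
      measurableSet_Ioi fun x hx => (hN x (hv.trans (le_of_lt hx))).le
  · refine Eventually.of_forall fun v => lt_of_le_of_lt ((div_le_one (hpos v)).2 ?_) ha
    rw [← one_mul (m.real _), ← hconst]
    exact setIntegral_mono hf.integrableOn (integrable_const (1 : ℝ)).integrableOn hf_le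

theorem setOf_lt_fst_eq_prod (v : ℝ) :
    {q : ℝ × ℝ | v < q.1} = Set.Ioi v ×ˢ (Set.univ : Set ℝ) := by
  ext q
  simp

/-- A `[0, 1]`-valued function on a product space that tends to `1` along the first coordinate
has conditional tail averages tending to `1`. -/
theorem tendsto_prod_tail_average (m ρ : Measure ℝ) [IsProbabilityMeasure m]
    [IsProbabilityMeasure ρ] (hm : ∀ v : ℝ, 0 < m (Set.Ioi v)) (g : ℝ × ℝ → ℝ)
    (hg : Measurable g) (hg_nonneg : ∀ q, 0 ≤ g q) (hg_le : ∀ q, g q ≤ 1)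
    (hg_lim : ∀ e, Tendsto (fun x => g (x, e)) atTop (𝓝 1)) :
    Tendsto (fun v => (∫ q in {q : ℝ × ℝ | v < q.1}, g q ∂(m.prod ρ)) /
      (m (Set.Ioi v)).toReal) atTop (𝓝 1) := by
  have hbound : ∀ q, ‖g q‖ ≤ 1 := fun q => by
    rw [Real.norm_of_nonneg (hg_nonneg q)]
    exact hg_le q
  have hint : Integrable g (m.prod ρ) :=
    Integrable.of_bound hg.aestronglyMeasurable 1 (Eventually.of_forall hbound)
  have hint_section : ∀ e, Integrable (fun x => g (x, e)) m := fun e =>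
    Integrable.of_bound (hg.comp measurable_prodMk_right).aestronglyMeasurable 1
      (Eventually.of_forall fun x => hbound (x, e))
  have hpos : ∀ v, 0 < m.real (Set.Ioi v) := fun v =>
    ENNReal.toReal_pos (hm v).ne' (measure_ne_top _ _)
  have hfubini : ∀ v, (∫ q in {q : ℝ × ℝ | v < q.1}, g q ∂(m.prod ρ)) / (m (Set.Ioi v)).toReal =
      ∫ e, (∫ x in Set.Ioi v, g (x, e) ∂m) / m.real (Set.Ioi v) ∂ρ := fun v => by
    have hrestrict : (m.prod ρ).restrict {q : ℝ × ℝ | v < q.1} =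
        (m.restrict (Set.Ioi v)).prod ρ := by
      rw [setOf_lt_fst_eq_prod, ← Measure.prod_restrict, Measure.restrict_univ]
    rw [integral_div, hrestrict, integral_prod_symm _ (hrestrict ▸ hint.restrict)]
    rfl
  simp_rw [hfubini]
  have hone : (1 : ℝ) = ∫ _, (1 : ℝ) ∂ρ := by simp
  rw [hone]
  refine tendsto_integral_filter_of_dominated_convergence (fun _ => 1)
    (Eventually.of_forall fun v => ?_) (Eventually.of_forall fun v => Eventually.of_forall fun e => ?_)
    (integrable_const _) (Eventually.of_forall fun e => ?_)
  · exact ((hg.stronglyMeasurable.integral_prod_left' (μ := m.restrict (Set.Ioi v))).measurable.div_const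
      _).aestronglyMeasurable
  · rw [norm_div, Real.norm_of_nonneg (hpos v).le, div_le_one (hpos v)]
    simpa using norm_setIntegral_le_of_norm_le_const (μ := m) (s := Set.Ioi v)
      (measure_lt_top _ _) fun x _ => hbound (x, e)
  · exact tendsto_tail_average m hm _ (hint_section e) (fun x => hg_le (x, e)) (hg_lim e)

/-- For a product measure, conditioning on the first coordinate does not change the average of
a function of the second coordinate. -/
theorem prod_tail_average_snd (m ρ : Measure ℝ) [IsProbabilityMeasure m]
    [IsProbabilityMeasure ρ] (G : ℝ → ℝ) {v : ℝ} (hv : 0 < m (Set.Ioi v)) :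
    (∫ q in {q : ℝ × ℝ | v < q.1}, G q.2 ∂(m.prod ρ)) / (m (Set.Ioi v)).toReal =
      ∫ q, G q.2 ∂(m.prod ρ) := by
  have hpos : 0 < (m (Set.Ioi v)).toReal := ENNReal.toReal_pos hv.ne' (measure_ne_top _ _)
  have hmul := setIntegral_prod_mul (μ := m) (ν := ρ) (fun _ => (1 : ℝ)) G (Set.Ioi v) Set.univ
  simp only [one_mul, setIntegral_const, smul_eq_mul, mul_one, Measure.restrict_univ] at hmul
  rw [setOf_lt_fst_eq_prod, hmul, integral_fun_snd, measureReal_def]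
  simp [hpos.ne']

/-- The mean of an integrable function that is everywhere less than `1` is less than `1`. -/
theorem integral_lt_one_of_forall_lt {α : Type*} [MeasurableSpace α] (P : Measure α)
    [IsProbabilityMeasure P] {g : α → ℝ} (hg : Integrable g P) (hg_lt : ∀ a, g a < 1) :
    ∫ a, g a ∂P < 1 := by
  have hsupport : Function.support (fun a => 1 - g a) = Set.univ :=
    Set.eq_univ_of_forall fun a => (sub_pos.2 (hg_lt a)).ne'
  have hpos : 0 < ∫ a, (1 - g a) ∂P := by
    rw [integral_pos_iff_support_of_nonneg (fun a => (sub_pos.2 (hg_lt a)).le)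
      ((integrable_const _).sub hg), hsupport]
    simp
  rw [integral_sub (integrable_const _) hg] at hpos
  simpa using hpos

/-- Propositions 1 and 2 of the paper: in the one-step structural model
`Y' = h(X, W, E)` with `κ` a regular conditional distribution of `(X, E)` given `W`
which is a.e. a product measure (conditional independence of the noise) whose first
marginal charges every neighbourhood of `+∞`:
(i) if `h(x, w, e) → ∞` as `x → ∞` for all `(w, e)`, then a.e. the causal tail
coefficient `Γ(w)` exists and equals `1`;
(ii) if `h` does not depend on its first argument, then a.e. `Γ(w)` exists and equals
the baseline `Γ^base(w)`, and `Γ^base(w) < 1`. -/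
theorem stmt14
    {Ω : Type*} [MeasurableSpace Ω] (μ : Measure Ω) [IsProbabilityMeasure μ]
    (k : ℕ) (W : Ω → (Fin k → ℝ)) (X E : Ω → ℝ)
    (hW : Measurable W) (hX : Measurable X) (hE : Measurable E)
    (h : ℝ → (Fin k → ℝ) → ℝ → ℝ)
    (hhmeas : Measurable fun q : ℝ × (Fin k → ℝ) × ℝ => h q.1 q.2.1 q.2.2)
    (Y' : Ω → ℝ) (hY' : ∀ ω, Y' ω = h (X ω) (W ω) (E ω))
    (κ : Kernel (Fin k → ℝ) (ℝ × ℝ)) [IsMarkovKernel κ]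
    (hκ : ∀ (C : Set (Fin k → ℝ)) (D : Set (ℝ × ℝ)),
      MeasurableSet C → MeasurableSet D →
      μ {ω | W ω ∈ C ∧ (X ω, E ω) ∈ D} = ∫⁻ w in C, κ w D ∂(Measure.map W μ))
    (hprod : ∀ᵐ w ∂(Measure.map W μ),
      κ w = ((κ w).map Prod.fst).prod ((κ w).map Prod.snd))
    (hsupp : ∀ᵐ w ∂(Measure.map W μ),
      ∀ v : ℝ, 0 < (κ w).map Prod.fst (Set.Ioi v))
    (F : ℝ → ℝ) (hF_mono : Monotone F) (hF_nonneg : ∀ x, 0 ≤ F x)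
    (hF_lt : ∀ x, F x < 1) (hF_lim : Tendsto F atTop (𝓝 1)) :
    ((∀ w e, Tendsto (fun x => h x w e) atTop atTop) →
      ∀ᵐ w ∂(Measure.map W μ),
        Tendsto (fun v =>
            (∫ q in {q : ℝ × ℝ | v < q.1}, F (h q.1 w q.2) ∂(κ w)) /
              ((κ w).map Prod.fst (Set.Ioi v)).toReal)
          atTop (𝓝 1))
    ∧ ((∀ x x' w e, h x w e = h x' w e) →
      ∀ᵐ w ∂(Measure.map W μ),
        Tendsto (fun v =>
            (∫ q in {q : ℝ × ℝ | v < q.1}, F (h q.1 w q.2) ∂(κ w)) /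
              ((κ w).map Prod.fst (Set.Ioi v)).toReal)
          atTop (𝓝 (∫ q, F (h q.1 w q.2) ∂(κ w))) ∧
        (∫ q, F (h q.1 w q.2) ∂(κ w)) < 1) := by
  have hmeas : ∀ w, Measurable fun q : ℝ × ℝ => F (h q.1 w q.2) := fun w =>
    hF_mono.measurable.comp (hhmeas.comp
      (measurable_fst.prodMk (measurable_const.prodMk measurable_snd)))
  have hprob_fst : ∀ w, IsProbabilityMeasure ((κ w).map Prod.fst) := fun w =>
    Measure.isProbabilityMeasure_map measurable_fst.aemeasurable
  have hprob_snd : ∀ w, IsProbabilityMeasure ((κ w).map Prod.snd) := fun w =>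
    Measure.isProbabilityMeasure_map measurable_snd.aemeasurable
  refine ⟨fun hlim => ?_, fun hindep => ?_⟩
  · filter_upwards [hprod, hsupp] with w hw hsw
    have key := tendsto_prod_tail_average _ ((κ w).map Prod.snd) hsw _ (hmeas w)
      (fun _ => hF_nonneg _) (fun _ => (hF_lt _).le) (fun e => hF_lim.comp (hlim w e))
    rwa [← hw] at key
  · filter_upwards [hprod, hsupp] with w hw hsw
    constructor
    · refine tendsto_const_nhds.congr fun v => ?_
      have key := prod_tail_average_snd _ ((κ w).map Prod.snd) (fun e => F (h 0 w e)) (hsw v)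
      rw [← hw] at key
      simp_rw [hindep _ 0 w]
      exact key.symm
    · refine integral_lt_one_of_forall_lt _ (Integrable.of_bound (hmeas w).aestronglyMeasurable 1
        (Eventually.of_forall fun q => ?_)) fun _ => hF_lt _
      rw [Real.norm_of_nonneg (hF_nonneg _)]
      exact (hF_lt _).le
end

section
/- Let (Ω, ℙ) be a probability space carrying random variables W : Ω → ℝ^k, X : Ω → ℝ and E : Ω → ℝ, let h : ℝ × ℝ^k × ℝ → ℝ be measurable satisfying Assumption A1: either h does not depend on its first argument, or lim_{x→∞} h(x, w, e) = +∞ for every (w, e). Let ν be the law of W and let κ be a regular conditional distribution of (X, E) given W such that for ν-almost every w, κ_w is a product measure μ_w ⊗ ρ_w with μ_w((v,∞)) > 0 for every v ∈ ℝ. For a nondecreasing F : ℝ → [0,1) with lim_{x→∞} F(x) = 1 define Γ_F(w) := lim_{v→∞} ( ∫ F(h(x,w,e)) 1{x > v} dκ_w(x,e) ) / μ_w((v,∞)) and Γ_F^baseline(w) := ∫ F(h(x,w,e)) dκ_w(x,e). Then for any two such functions F₁ and F₂: Γ_{F₁}(w) ≠ Γ_{F₁}^baseline(w) for ν-almost every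 w if and only if Γ_{F₂}(w) ≠ Γ_{F₂}^baseline(w) for ν-almost every w. -/
open MeasureTheory ProbabilityTheory Filter
open scoped Topology

/-- Averages over the upper tails of a measure inherit the limit at infinity of the integrand. -/
theorem tendsto_integral_Ioi_div_measure_Ioi {m : Measure ℝ} [IsFiniteMeasure m] {f : ℝ → ℝ}
    {c : ℝ} (hf : Integrable f m) (hm : ∀ v, 0 < m (Set.Ioi v)) (hlim : Tendsto f atTop (𝓝 c)) :
    Tendsto (fun v => (∫ x in Set.Ioi v, f x ∂m) / (m (Set.Ioi v)).toReal) atTop (𝓝 c) := by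
  rw [Metric.nhds_basis_closedBall.tendsto_right_iff]
  intro ε hε
  obtain ⟨v₀, hv₀⟩ := eventually_atTop.1 (hlim.eventually (Metric.closedBall_mem_nhds c hε))
  filter_upwards [eventually_ge_atTop v₀] with v hv
  have hmem := (convex_closedBall c ε).set_average_mem Metric.isClosed_closedBall (hm v).ne'
    (measure_ne_top m _) (ae_restrict_of_forall_mem measurableSet_Ioi
      fun x (hx : v < x) => hv₀ x (hv.trans hx.le)) hf.integrableOn
  rwa [setAverage_eq, smul_eq_mul, inv_mul_eq_div] at hmem

theorem setIntegral_lt_fst_prod {m n : Measure ℝ} [IsFiniteMeasure m] [IsFiniteMeasure n]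
    {g : ℝ × ℝ → ℝ} (hg : Integrable g (m.prod n)) (v : ℝ) :
    ∫ q in {q : ℝ × ℝ | v < q.1}, g q ∂(m.prod n) = ∫ e, ∫ x in Set.Ioi v, g (x, e) ∂m ∂n := by
  have hset : {q : ℝ × ℝ | v < q.1} = Set.Ioi v ×ˢ Set.univ := by ext; simp
  have hres : (m.prod n).restrict {q : ℝ × ℝ | v < q.1} = (m.restrict (Set.Ioi v)).prod n := by
    rw [hset, ← Measure.prod_restrict, Measure.restrict_univ]
  rw [hres, integral_prod_symm]
  rw [← hres]
  exact hg.restrict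

/-- Under a product measure, conditioning on large values of the first coordinate sends the mean of
a bounded function to the limit of that function along the first coordinate. -/
theorem tendsto_setIntegral_lt_fst_prod_div {m n : Measure ℝ} [IsFiniteMeasure m]
    [IsProbabilityMeasure n] {g : ℝ × ℝ → ℝ} {c : ℝ} (hg : Measurable g) (hg0 : ∀ q, 0 ≤ g q)
    (hg1 : ∀ q, g q < 1) (hm : ∀ v, 0 < m (Set.Ioi v))
    (hlim : ∀ e, Tendsto (fun x => g (x, e)) atTop (𝓝 c)) :
    Tendsto (fun v => (∫ q in {q : ℝ × ℝ | v < q.1}, g q ∂(m.prod n)) / (m (Set.Ioi v)).toReal)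
      atTop (𝓝 c) := by
  have hbound : ∀ q, ‖g q‖ ≤ 1 := fun q => by
    rw [Real.norm_of_nonneg (hg0 q)]; exact (hg1 q).le
  have hint : Integrable g (m.prod n) :=
    .of_bound hg.aestronglyMeasurable 1 (.of_forall hbound)
  simp_rw [setIntegral_lt_fst_prod hint]
  refine Tendsto.congr (fun v => integral_div _ _) ?_
  have hc : c = ∫ _, c ∂n := by simp
  rw [hc]
  refine tendsto_integral_filter_of_dominated_convergence (fun _ => 1) ?_ ?_
    (integrable_const 1) (.of_forall fun e => ?_)
  · refine .of_forall fun v => ?_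
    exact ((hg.stronglyMeasurable.integral_prod_left'
      (μ := m.restrict (Set.Ioi v))).measurable.div_const _).aestronglyMeasurable
  · refine .of_forall fun v => .of_forall fun e => ?_
    rw [norm_div, Real.norm_of_nonneg ENNReal.toReal_nonneg]
    refine div_le_one_of_le₀ ?_ ENNReal.toReal_nonneg
    simpa [Measure.real] using norm_setIntegral_le_of_norm_le_const (μ := m) (s := Set.Ioi v)
      (measure_lt_top m _) fun x _ => hbound (x, e)
  · exact tendsto_integral_Ioi_div_measure_Ioi
      (.of_bound (hg.comp measurable_prodMk_right).aestronglyMeasurable 1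
        (.of_forall fun x => hbound (x, e))) hm (hlim e)

theorem integral_lt_one_of_forall_lt_one {α : Type*} [MeasurableSpace α] {P : Measure α}
    [IsProbabilityMeasure P] {g : α → ℝ} (hg : Integrable g P) (hg1 : ∀ q, g q < 1) :
    ∫ q, g q ∂P < 1 := by
  have hpos : 0 < ∫ q, (1 - g q) ∂P := by
    rw [integral_pos_iff_support_of_nonneg (fun q => (sub_pos.2 (hg1 q)).le)
      ((integrable_const 1).sub hg)]
    have : Function.support (fun q => 1 - g q) = Set.univ :=
      Set.eq_univ_of_forall fun q => (sub_pos.2 (hg1 q)).ne'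
    simp [this]
  rw [integral_sub (integrable_const 1) hg] at hpos
  simpa using hpos

/-- A bounded function that does not depend on the first coordinate has, under a product measure,
the same mean after conditioning on the first coordinate being large. -/
theorem tendsto_setIntegral_lt_fst_prod_div_of_const {m n : Measure ℝ} [IsProbabilityMeasure m]
    [IsFiniteMeasure n] {g : ℝ × ℝ → ℝ} (hg : Integrable g (m.prod n))
    (hm : ∀ v, 0 < m (Set.Ioi v)) (hconst : ∀ x x' e, g (x, e) = g (x', e)) :
    Tendsto (fun v => (∫ q in {q : ℝ × ℝ | v < q.1}, g q ∂(m.prod n)) / (m (Set.Ioi v)).toReal)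
      atTop (𝓝 (∫ q, g q ∂(m.prod n))) := by
  refine tendsto_const_nhds.congr fun v => ?_
  have hpos : (m (Set.Ioi v)).toReal ≠ 0 :=
    (ENNReal.toReal_pos (hm v).ne' (measure_ne_top m _)).ne'
  rw [setIntegral_lt_fst_prod hg, integral_prod_symm _ hg, eq_div_iff hpos, ← integral_mul_const]
  refine integral_congr_ae (.of_forall fun e => ?_)
  simp [hconst _ 0 e, Measure.real, mul_comm]

/-- Lemma 1 of the paper: under Assumption A1 (either `h` does not
depend on its first argument, or `h(x,w,e) → ∞` as `x → ∞` for all `(w,e)`) and the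
conditional-independence / conditional-support assumptions on the regular conditional
distribution `κ` of `(X, E)` given `W`, the notion of tail causality
`Γ_F(w) ≠ Γ_F^base(w)` (ν-a.e.) does not depend on the choice of the nondecreasing
function `F : ℝ → [0,1)` with `F → 1` at `∞`. -/
theorem stmt15
    {Ω : Type*} [MeasurableSpace Ω] (μ : Measure Ω) [IsProbabilityMeasure μ]
    (k : ℕ) (W : Ω → (Fin k → ℝ)) (X E : Ω → ℝ)
    (hW : Measurable W) (hX : Measurable X) (hE : Measurable E)
    (h : ℝ → (Fin k → ℝ) → ℝ → ℝ)
    (hhmeas : Measurable fun q : ℝ × (Fin k → ℝ) × ℝ => h q.1 q.2.1 q.2.2)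
    (hA1 : (∀ x x' w e, h x w e = h x' w e) ∨
      (∀ w e, Tendsto (fun x => h x w e) atTop atTop))
    (κ : Kernel (Fin k → ℝ) (ℝ × ℝ)) [IsMarkovKernel κ]
    (hκ : ∀ (C : Set (Fin k → ℝ)) (D : Set (ℝ × ℝ)),
      MeasurableSet C → MeasurableSet D →
      μ {ω | W ω ∈ C ∧ (X ω, E ω) ∈ D} = ∫⁻ w in C, κ w D ∂(Measure.map W μ))
    (hprod : ∀ᵐ w ∂(Measure.map W μ),
      κ w = ((κ w).map Prod.fst).prod ((κ w).map Prod.snd))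
    (hsupp : ∀ᵐ w ∂(Measure.map W μ),
      ∀ v : ℝ, 0 < (κ w).map Prod.fst (Set.Ioi v))
    (F₁ F₂ : ℝ → ℝ)
    (hF₁_mono : Monotone F₁) (hF₁_nonneg : ∀ x, 0 ≤ F₁ x)
    (hF₁_lt : ∀ x, F₁ x < 1) (hF₁_lim : Tendsto F₁ atTop (𝓝 1))
    (hF₂_mono : Monotone F₂) (hF₂_nonneg : ∀ x, 0 ≤ F₂ x)
    (hF₂_lt : ∀ x, F₂ x < 1) (hF₂_lim : Tendsto F₂ atTop (𝓝 1)) :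
    (∀ᵐ w ∂(Measure.map W μ),
      ¬ Tendsto (fun v =>
            (∫ q in {q : ℝ × ℝ | v < q.1}, F₁ (h q.1 w q.2) ∂(κ w)) /
              ((κ w).map Prod.fst (Set.Ioi v)).toReal)
          atTop (𝓝 (∫ q, F₁ (h q.1 w q.2) ∂(κ w))))
    ↔ (∀ᵐ w ∂(Measure.map W μ),
      ¬ Tendsto (fun v =>
            (∫ q in {q : ℝ × ℝ | v < q.1}, F₂ (h q.1 w q.2) ∂(κ w)) /
              ((κ w).map Prod.fst (Set.Ioi v)).toReal)
          atTop (𝓝 (∫ q, F₂ (h q.1 w q.2) ∂(κ w)))) := by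
  have meas : ∀ {F : ℝ → ℝ}, Monotone F → ∀ w,
      Measurable fun q : ℝ × ℝ => F (h q.1 w q.2) := fun hF w =>
    hF.measurable.comp (hhmeas.comp (by fun_prop : Measurable fun q : ℝ × ℝ => (q.1, w, q.2)))
  have integ : ∀ {F : ℝ → ℝ}, Monotone F → (∀ x, 0 ≤ F x) → (∀ x, F x < 1) → ∀ w,
      Integrable (fun q : ℝ × ℝ => F (h q.1 w q.2)) (κ w) := fun hF hF0 hF1 w =>
    .of_bound (meas hF w).aestronglyMeasurable 1
      (.of_forall fun q => by rw [Real.norm_of_nonneg (hF0 _)]; exact (hF1 _).le)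
  have hfst : ∀ w, IsProbabilityMeasure ((κ w).map Prod.fst) := fun w =>
    Measure.isProbabilityMeasure_map measurable_fst.aemeasurable
  have hsnd : ∀ w, IsProbabilityMeasure ((κ w).map Prod.snd) := fun w =>
    Measure.isProbabilityMeasure_map measurable_snd.aemeasurable
  refine eventually_congr ?_
  filter_upwards [hprod, hsupp] with w hw hs
  rcases hA1 with hconst | hlim
  · have key : ∀ {F : ℝ → ℝ}, Monotone F → (∀ x, 0 ≤ F x) → (∀ x, F x < 1) →
        Tendsto (fun v => (∫ q in {q : ℝ × ℝ | v < q.1}, F (h q.1 w q.2) ∂(κ w)) /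
          ((κ w).map Prod.fst (Set.Ioi v)).toReal)
          atTop (𝓝 (∫ q, F (h q.1 w q.2) ∂(κ w))) := by
      intro F hF hF0 hF1
      have hi := integ hF hF0 hF1 w
      have := tendsto_setIntegral_lt_fst_prod_div_of_const (hw ▸ hi) hs
        fun x x' e => congrArg F (hconst x x' w e)
      rwa [← hw] at this
    exact iff_of_false (not_not.2 (key hF₁_mono hF₁_nonneg hF₁_lt))
      (not_not.2 (key hF₂_mono hF₂_nonneg hF₂_lt))
  · have key : ∀ {F : ℝ → ℝ}, Monotone F → (∀ x, 0 ≤ F x) → (∀ x, F x < 1) →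
        Tendsto F atTop (𝓝 1) →
        ¬ Tendsto (fun v => (∫ q in {q : ℝ × ℝ | v < q.1}, F (h q.1 w q.2) ∂(κ w)) /
          ((κ w).map Prod.fst (Set.Ioi v)).toReal)
          atTop (𝓝 (∫ q, F (h q.1 w q.2) ∂(κ w))) := by
      intro F hF hF0 hF1 hFlim hT
      have := tendsto_setIntegral_lt_fst_prod_div (n := (κ w).map Prod.snd) (meas hF w)
        (fun _ => hF0 _) (fun _ => hF1 _) hs fun e => hFlim.comp (hlim w e)
      rw [← hw] at this
      exact (integral_lt_one_of_forall_lt_one (integ hF hF0 hF1 w) fun _ => hF1 _).ne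
        (tendsto_nhds_unique hT this)
    exact iff_of_true (key hF₁_mono hF₁_nonneg hF₁_lt hF₁_lim)
      (key hF₂_mono hF₂_nonneg hF₂_lt hF₂_lim)
end
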